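/- arXiv:1704.05178 — 4 statements merged into one kernel-verified Lean document; each statement's English description precedes it below -/
import Mathlib

section
/- Suppose Q has no loops (i.e., hb ≠ tb for every arrow b ∈ Q₁). Let φ be a representation of Q on V and let F(•) be a flag of type (𝐢, 𝐚). Then F(•) is φ-stable if and only if F(•) is strictly φ-stable. -/
open scoped BigOperators

/-- For a quiver without loops, a flag of type `(𝐢, 𝐚)` is `φ`-stable
if and only if it is strictly `φ`-stable. -/
theorem stmt_0
    -- the quiver: vertex set `Q0`, arrow set `Q1`, head and tail maps
    (Q0 Q1 : Type) [Fintype Q0] [Fintype Q1] [DecidableEq Q0]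
    (hd tl : Q1 → Q0)
    -- the `Q0`-graded vector space `V`
    (V : Q0 → Type) [∀ i, AddCommGroup (V i)] [∀ i, Module ℂ (V i)]
    [∀ i, FiniteDimensional ℂ (V i)]
    -- a representation of `Q` on `V`
    (φ : ∀ b : Q1, V (tl b) →ₗ[ℂ] V (hd b))
    -- the sequences `𝐢` and `𝐚`
    (m : ℕ) (iseq : Fin m → Q0) (aseq : Fin m → ℕ)
    (haseq : ∀ k, 0 < aseq k)
    (hdim : ∀ i : Q0, Module.finrank ℂ (V i)
      = ∑ k ∈ Finset.univ.filter (fun k => iseq k = i), aseq k)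
    -- a flag of type `(𝐢, 𝐚)`: a decreasing chain of graded subspaces
    (F : Fin (m + 1) → ∀ i : Q0, Submodule ℂ (V i))
    (htop : ∀ i, F 0 i = ⊤)
    (hbot : ∀ i, F (Fin.last m) i = ⊥)
    (hdec : ∀ (k : Fin m) (i : Q0), F k.succ i ≤ F k.castSucc i)
    (hjump : ∀ (k : Fin m) (i : Q0),
      Module.finrank ℂ (F k.castSucc i)
        = Module.finrank ℂ (F k.succ i) + (if iseq k = i then aseq k else 0))
    -- the quiver has no loops
    (hnoloop : ∀ b : Q1, hd b ≠ tl b) :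
    -- φ-stable ↔ strictly φ-stable
    (∀ (b : Q1) (k : Fin m), (F k.succ (tl b)).map (φ b) ≤ F k.succ (hd b)) ↔
    (∀ (b : Q1) (k : Fin m), (F k.castSucc (tl b)).map (φ b) ≤ F k.succ (hd b)) := by
  have heq : ∀ (k : Fin m) (i : Q0), iseq k ≠ i → F k.succ i = F k.castSucc i := by
    intro k i hk
    refine Submodule.eq_of_le_of_finrank_eq (hdec k i) ?_
    rw [hjump k i, if_neg hk, add_zero]
  constructor
  · intro h b k
    have hstable : ∀ j : Fin (m + 1), (F j (tl b)).map (φ b) ≤ F j (hd b) := by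
      intro j
      induction j using Fin.cases with
      | zero => rw [htop (hd b)]; exact le_top
      | succ j => exact h b j
    by_cases hk : iseq k = tl b
    · rw [heq k (hd b) fun hk' => hnoloop b (hk'.symm.trans hk)]
      exact hstable k.castSucc
    · rw [← heq k (tl b) hk]
      exact h b k
  · intro h b k
    exact (Submodule.map_mono (hdec k (tl b))).trans (h b k)
end

section
/- Suppose Q has no loops (i.e., hb ≠ tb for every arrow b ∈ Q₁). Then a representation φ of Q on V is nilpotent if and only if there exist sequences 𝐢 = (i₁, …, i_m) of vertices and 𝐚 = (a₁, …, a_m) of positive integers with dim V^{(i)} = Σ_{k : i_k = i} a_k for every vertex i, together with a φ-stable flag of type (𝐢, 𝐚). -/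
open scoped BigOperators

section Defs

variable {Q0 Q1 : Type} [DecidableEq Q0] (hd tl : Q1 → Q0)
variable (V : Q0 → Type) [∀ i, AddCommGroup (V i)] [∀ i, Module ℂ (V i)]

/-- The endomorphism of `Π i, V i` induced by the map `φ b : V (tl b) → V (hd b)`
of a quiver representation; it reads off the component at the tail of `b`, applies `φ b`,
and places the result at the head of `b`. -/
def quiverStep (φ : ∀ b : Q1, V (tl b) →ₗ[ℂ] V (hd b)) (b : Q1)
    (w : ∀ i, V i) : ∀ i, V i :=
  fun i => if h : hd b = i then h ▸ (φ b (w (tl b))) else 0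

/-- The composite of the maps `φ_b` along the sequence of arrows `p 0, p 1, …, p (N-1)`
(applying `p 0` first), transported to `Π i, V i`. -/
def pathComp (φ : ∀ b : Q1, V (tl b) →ₗ[ℂ] V (hd b)) {N : ℕ} (p : Fin N → Q1) :
    (∀ i, V i) → (∀ i, V i) :=
  (List.ofFn (fun j => quiverStep hd tl V φ (p j))).reverse.foldr (· ∘ ·) id

/-- `p` is a directed path in the quiver: the head of each arrow is the tail of the next. -/
def IsDirPath {N : ℕ} (p : Fin N → Q1) : Prop :=
  ∀ (j : ℕ) (hj : j + 1 < N), hd (p ⟨j, Nat.lt_of_succ_lt hj⟩) = tl (p ⟨j + 1, hj⟩)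

/-- Nilpotence of a quiver representation: for some `N ≥ 1`, the composite of the maps
`φ_b` along any directed path with `N` arrows is the zero map. -/
def IsNilpotentRep (φ : ∀ b : Q1, V (tl b) →ₗ[ℂ] V (hd b)) : Prop :=
  ∃ N : ℕ, 1 ≤ N ∧ ∀ p : Fin N → Q1, IsDirPath hd tl p →
    ∀ w : ∀ i, V i, pathComp hd tl V φ p w = 0

end Defs

section Helpers

variable {Q0 Q1 : Type} [DecidableEq Q0] {hd tl : Q1 → Q0}
variable {V : Q0 → Type} [∀ i, AddCommGroup (V i)] [∀ i, Module ℂ (V i)]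

theorem pathComp_succ (φ : ∀ b : Q1, V (tl b) →ₗ[ℂ] V (hd b)) {n : ℕ} (p : Fin (n + 1) → Q1)
    (w : ∀ i, V i) :
    pathComp hd tl V φ p w =
      quiverStep hd tl V φ (p (Fin.last n)) (pathComp hd tl V φ (fun j => p j.castSucc) w) := by
  rw [pathComp, List.ofFn_succ', List.concat_eq_append, List.reverse_append]
  rfl

theorem quiverStep_hd (φ : ∀ b : Q1, V (tl b) →ₗ[ℂ] V (hd b)) (b : Q1) (w : ∀ i, V i) :
    quiverStep hd tl V φ b w (hd b) = φ b (w (tl b)) := by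
  simp [quiverStep]

/-- `PathImage φ n i x` says that `x : V i` is a value of the composite of `φ` along some directed
path with `n` arrows ending at `i`. -/
inductive PathImage (φ : ∀ b : Q1, V (tl b) →ₗ[ℂ] V (hd b)) : ℕ → ∀ i, V i → Prop
  | zero (i : Q0) (x : V i) : PathImage φ 0 i x
  | step {n : ℕ} (b : Q1) (x : V (tl b)) :
      PathImage φ n (tl b) x → PathImage φ (n + 1) (hd b) (φ b x)

theorem PathImage.exists_pathComp {φ : ∀ b : Q1, V (tl b) →ₗ[ℂ] V (hd b)} {n : ℕ} {i : Q0}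
    {x : V i} (hx : PathImage φ n i x) :
    ∃ (p : Fin n → Q1) (w : ∀ i, V i), IsDirPath hd tl p ∧
      (∀ (j : ℕ) (hj : j + 1 = n), hd (p ⟨j, by omega⟩) = i) ∧
      pathComp hd tl V φ p w i = x := by
  induction hx with
  | zero i x =>
    refine ⟨Fin.elim0, Function.update 0 i x, fun j hj => absurd hj (by omega),
      fun j hj => absurd hj (by omega), ?_⟩
    simp [pathComp]
  | @step n b x _ ih =>
    obtain ⟨p, w, hp, hlast, rfl⟩ := ih
    refine ⟨Fin.snoc p b, w, ?_, ?_, ?_⟩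
    · intro j hj
      have hjn : j < n := by omega
      by_cases h : j + 1 < n
      · simpa [Fin.snoc, hjn, h] using hp j h
      · simpa [Fin.snoc, hjn, h] using hlast j (by omega)
    · intro j hj
      obtain rfl : j = n := by omega
      simp [Fin.snoc]
    · rw [pathComp_succ]
      simp [quiverStep_hd]

/-- A graded subspace is `φ`-stable. -/
def IsStableSub (φ : ∀ b : Q1, V (tl b) →ₗ[ℂ] V (hd b)) (F : ∀ i, Submodule ℂ (V i)) : Prop :=
  ∀ b, (F (tl b)).map (φ b) ≤ F (hd b)

/-- A proper graded subspace misses a vector all of whose images under arrows it contains, provided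
the representation is nilpotent. -/
theorem IsNilpotentRep.exists_notMem {φ : ∀ b : Q1, V (tl b) →ₗ[ℂ] V (hd b)}
    (hφ : IsNilpotentRep hd tl V φ) {F : ∀ i, Submodule ℂ (V i)} (hF : F ≠ ⊤) :
    ∃ (i : Q0) (x : V i), x ∉ F i ∧ ∀ (b : Q1) (h : i = tl b), φ b (h ▸ x) ∈ F (hd b) := by
  by_contra! hcon
  obtain ⟨N, -, hN⟩ := hφ
  have key : ∀ k n, n + k = N → ∀ i (x : V i), PathImage φ n i x → x ∈ F i := by
    intro k
    induction k with
    | zero =>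
      rintro n rfl i x hx
      obtain ⟨p, w, hp, -, rfl⟩ := hx.exists_pathComp
      simp [hN p hp w]
    | succ k ih =>
      intro n hn i x hx
      by_contra hxF
      obtain ⟨b, rfl, hb⟩ := hcon i x hxF
      exact hb (ih (n + 1) (by omega) _ _ (PathImage.step b x hx))
  exact hF (funext fun i => (Submodule.eq_top_iff'.2 fun x =>
    key N 0 (by omega) i x (PathImage.zero i x)))

/-- `F` is the first member of a `φ`-stable flag ending in `0`. -/
def HasStableFlag (φ : ∀ b : Q1, V (tl b) →ₗ[ℂ] V (hd b)) (F : ∀ i, Submodule ℂ (V i)) : Prop :=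
  ∃ (m : ℕ) (iseq : Fin m → Q0) (aseq : Fin m → ℕ),
    (∀ k, 0 < aseq k) ∧
    (∀ i : Q0, Module.finrank ℂ (F i)
      = ∑ k ∈ Finset.univ.filter (fun k => iseq k = i), aseq k) ∧
    ∃ G : Fin (m + 1) → ∀ i : Q0, Submodule ℂ (V i),
      (∀ i, G 0 i = F i) ∧
      (∀ i, G (Fin.last m) i = ⊥) ∧
      (∀ (k : Fin m) (i : Q0), G k.succ i ≤ G k.castSucc i) ∧
      (∀ (k : Fin m) (i : Q0),
        Module.finrank ℂ (G k.castSucc i)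
          = Module.finrank ℂ (G k.succ i) + (if iseq k = i then aseq k else 0)) ∧
      (∀ (b : Q1) (k : Fin m), (G k.succ (tl b)).map (φ b) ≤ G k.succ (hd b))

theorem hasStableFlag_bot (φ : ∀ b : Q1, V (tl b) →ₗ[ℂ] V (hd b)) :
    HasStableFlag φ (fun _ => ⊥) :=
  ⟨0, Fin.elim0, Fin.elim0, fun k => k.elim0, by simp, fun _ _ => ⊥, by simp, by simp,
    fun k => k.elim0, fun k => k.elim0, fun _ k => k.elim0⟩

theorem HasStableFlag.cons {φ : ∀ b : Q1, V (tl b) →ₗ[ℂ] V (hd b)}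
    {F F' : ∀ i, Submodule ℂ (V i)} (h : HasStableFlag φ F) (hF : IsStableSub φ F)
    (hle : ∀ i, F i ≤ F' i) (i₀ : Q0) {a : ℕ} (ha : 0 < a)
    (hrank : ∀ i, Module.finrank ℂ (F' i) =
      Module.finrank ℂ (F i) + (if i₀ = i then a else 0)) :
    HasStableFlag φ F' := by
  obtain ⟨m, iseq, aseq, hpos, hsum, G, h0, hlast, hmono, hfin, hst⟩ := h
  refine ⟨m + 1, Fin.cons i₀ iseq, Fin.cons a aseq, ?_, ?_, Fin.cons F' G, ?_, ?_, ?_, ?_, ?_⟩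
  · exact Fin.cases ha hpos
  · intro i
    rw [hrank, hsum, Finset.sum_filter, Finset.sum_filter, Fin.sum_univ_succ]
    simp [add_comm]
  · simp
  · intro i
    rw [← Fin.succ_last]
    simpa using hlast i
  · refine Fin.cases ?_ ?_
    · simpa [h0] using hle
    · intro k i
      simpa [← Fin.succ_castSucc] using hmono k i
  · refine Fin.cases ?_ ?_
    · intro i
      have := hrank i
      rw [← h0] at this
      exact this
    · exact hfin
  · intro b
    refine Fin.cases ?_ ?_
    · simpa [h0] using hF b
    · intro k
      simpa using hst b k

theorem finrank_sup_span_singleton {W : Type*} [AddCommGroup W] [Module ℂ W]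
    [FiniteDimensional ℂ W] (S : Submodule ℂ W) {x : W} (hx : x ∉ S) :
    Module.finrank ℂ ↥(S ⊔ Submodule.span ℂ {x}) = Module.finrank ℂ S + 1 := by
  have hx0 : x ≠ 0 := fun h => hx (h ▸ S.zero_mem)
  have hdisj : S ⊓ Submodule.span ℂ {x} = ⊥ :=
    disjoint_iff.1 ((Submodule.disjoint_span_singleton' hx0).2 hx)
  have := Submodule.finrank_sup_add_finrank_inf_eq S (Submodule.span ℂ {x})
  rwa [hdisj, finrank_bot, finrank_span_singleton hx0, add_zero] at this

theorem IsNilpotentRep.hasStableFlag_top [Finite Q0] [∀ i, FiniteDimensional ℂ (V i)]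
    {φ : ∀ b : Q1, V (tl b) →ₗ[ℂ] V (hd b)} (hφ : IsNilpotentRep hd tl V φ)
    (F : ∀ i, Submodule ℂ (V i)) (hst : IsStableSub φ F) (hflag : HasStableFlag φ F) :
    HasStableFlag φ (⊤ : ∀ i, Submodule ℂ (V i)) := by
  have : WellFoundedGT (∀ i, Submodule ℂ (V i)) :=
    ⟨(Pi.wellFoundedLT (α := fun i => (Submodule ℂ (V i))ᵒᵈ)).wf⟩
  induction F using WellFoundedGT.induction with
  | ind F ih =>
  by_cases hF : F = ⊤
  · exact hF ▸ hflag
  obtain ⟨i, x, hx, hφx⟩ := hφ.exists_notMem hF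
  set S := F i ⊔ Submodule.span ℂ {x} with hS
  have hle : ∀ j, F j ≤ Function.update F i S j := by
    intro j
    by_cases hj : j = i
    · subst hj
      simp [hS]
    · simp [hj]
  refine ih (Function.update F i S) (lt_of_le_of_ne hle fun h => hx ?_) ?_
    (hflag.cons hst hle i one_pos ?_)
  · rw [h]
    simpa [hS] using Submodule.mem_sup_right (Submodule.mem_span_singleton_self x)
  · intro b
    refine le_trans ?_ (hle (hd b))
    by_cases hb : i = tl b
    · subst hb
      rw [Function.update_self, hS, Submodule.map_sup, sup_le_iff]
      refine ⟨hst b, ?_⟩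
      rw [Submodule.map_span, Submodule.span_le]
      simpa using hφx b rfl
    · rw [Function.update_of_ne (Ne.symm hb)]
      exact hst b
  · intro j
    by_cases hj : i = j
    · subst hj
      rw [Function.update_self, if_pos rfl, hS, finrank_sup_span_singleton _ hx]
    · rw [Function.update_of_ne (Ne.symm hj), if_neg hj, add_zero]

/-- In the absence of loops an arrow maps each member of a `φ`-stable flag into the next one. -/
theorem HasStableFlag.isNilpotentRep [∀ i, FiniteDimensional ℂ (V i)]
    {φ : ∀ b : Q1, V (tl b) →ₗ[ℂ] V (hd b)} (hnoloop : ∀ b : Q1, hd b ≠ tl b)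
    (h : HasStableFlag φ (⊤ : ∀ i, Submodule ℂ (V i))) : IsNilpotentRep hd tl V φ := by
  obtain ⟨m, iseq, aseq, -, -, G, h0, hlast, hmono, hfin, hst⟩ := h
  have heq : ∀ (k : Fin m) i, iseq k ≠ i → G k.succ i = G k.castSucc i := fun k i hi =>
    Submodule.eq_of_le_of_finrank_eq (hmono k i) (by simp [hfin k i, hi])
  have hstab : ∀ k, IsStableSub φ (G k) := by
    refine Fin.cases (fun b => ?_) (fun k b => hst b k)
    rw [h0 (hd b)]
    exact le_top
  have hstep : ∀ (k : Fin m) (b : Q1) (x : V (tl b)),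
      x ∈ G k.castSucc (tl b) → φ b x ∈ G k.succ (hd b) := by
    intro k b x hx
    by_cases hk : iseq k = tl b
    · rw [heq k (hd b) fun h => hnoloop b (h.symm.trans hk)]
      exact hstab _ b (Submodule.mem_map_of_mem hx)
    · rw [← heq k (tl b) hk] at hx
      exact hstab _ b (Submodule.mem_map_of_mem hx)
  have hpath : ∀ (n : ℕ) (p : Fin n → Q1) (w : ∀ i, V i) (k : Fin (m + 1)), (k : ℕ) ≤ n →
      ∀ i, pathComp hd tl V φ p w i ∈ G k i := by
    intro n
    induction n with
    | zero =>
      intro p w k hk i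
      obtain rfl : k = 0 := Fin.ext (by simpa using hk)
      simp [h0]
    | succ n ih =>
      intro p w k hk i
      induction k using Fin.cases with
      | zero => simp [h0]
      | succ k =>
        rw [pathComp_succ]
        by_cases hi : hd (p (Fin.last n)) = i
        · subst hi
          rw [quiverStep_hd]
          exact hstep k _ _ (ih _ w k.castSucc (by simpa using hk) _)
        · simp [quiverStep, hi]
  refine ⟨m + 1, by omega, fun p _ w => funext fun i => ?_⟩
  have := hpath (m + 1) p w (Fin.last m) (by simp) i
  rwa [hlast, Submodule.mem_bot] at this

end Helpers

/-- For a quiver without loops, a representation `φ` is nilpotent if and only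
if there exist sequences `𝐢`, `𝐚` (with the dimension compatibility) together with
a `φ`-stable flag of type `(𝐢, 𝐚)`. -/
theorem stmt_1
    (Q0 Q1 : Type) [Fintype Q0] [Fintype Q1] [DecidableEq Q0]
    (hd tl : Q1 → Q0)
    (V : Q0 → Type) [∀ i, AddCommGroup (V i)] [∀ i, Module ℂ (V i)]
    [∀ i, FiniteDimensional ℂ (V i)]
    (φ : ∀ b : Q1, V (tl b) →ₗ[ℂ] V (hd b))
    (hnoloop : ∀ b : Q1, hd b ≠ tl b) :
    IsNilpotentRep hd tl V φ ↔
    ∃ (m : ℕ) (iseq : Fin m → Q0) (aseq : Fin m → ℕ),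
      (∀ k, 0 < aseq k) ∧
      (∀ i : Q0, Module.finrank ℂ (V i)
        = ∑ k ∈ Finset.univ.filter (fun k => iseq k = i), aseq k) ∧
      ∃ F : Fin (m + 1) → ∀ i : Q0, Submodule ℂ (V i),
        (∀ i, F 0 i = ⊤) ∧
        (∀ i, F (Fin.last m) i = ⊥) ∧
        (∀ (k : Fin m) (i : Q0), F k.succ i ≤ F k.castSucc i) ∧
        (∀ (k : Fin m) (i : Q0),
          Module.finrank ℂ (F k.castSucc i)
            = Module.finrank ℂ (F k.succ i) + (if iseq k = i then aseq k else 0)) ∧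
        -- φ-stability
        (∀ (b : Q1) (k : Fin m), (F k.succ (tl b)).map (φ b) ≤ F k.succ (hd b)) := by
  have hiff : IsNilpotentRep hd tl V φ ↔ HasStableFlag φ (⊤ : ∀ i, Submodule ℂ (V i)) :=
    ⟨fun h => h.hasStableFlag_top (fun _ => ⊥) (fun b => by simp) (hasStableFlag_bot φ),
      HasStableFlag.isNilpotentRep hnoloop⟩
  simpa only [HasStableFlag, Pi.top_apply, finrank_top] using hiff
end

section
/- Let Q be the cyclic quiver with r ≥ 2 vertices: Q₀ = ℤ/rℤ with exactly one arrow i → i+1 for each i, with arrow variable t_{i,i+1}. Then there exist integers a_0, …, a_{r−2} ∈ ℤ and a polynomial 𝒦^red ∈ ℤ[t] such that 𝒦^{𝐢,𝐚}_{λ•,μ(•)}(t_{Q₁}) = (∏_{i=0}^{r−2} t_{i,i+1}^{a_i}) · 𝒦^red(t_{01} t_{12} ⋯ t_{r−1,0}); moreover, if 𝒦^{𝐢,𝐚}_{λ•,μ(•)}(t_{Q₁}) ≠ 0 then the Laurent monomial ∏_{i=0}^{r−2} t_{i,i+1}^{a_i} and the polynomial 𝒦^red are unique. -/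
open scoped BigOperators

namespace QKS

/-- The coordinates of `X• = ∏_i ℤ^{ν^{(i)}}`, indexed by their block `k` (with `i_k = i`)
and position `p` within the block.  The coordinates at vertex `i` are those with
`iseq k = i`, ordered lexicographically by `(k, p)`. -/
abbrev Coord (m : ℕ) (a : Fin m → ℕ) : Type := (k : Fin m) × Fin (a k)

/-- The (strict) order on coordinates: lexicographic by block, then position. -/
abbrev coordLT {m : ℕ} {a : Fin m → ℕ} (x y : Coord m a) : Prop :=
  x.1 < y.1 ∨ (x.1 = y.1 ∧ (x.2 : ℕ) < (y.2 : ℕ))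

variable {Q0 Q1 : Type} [Fintype Q0] [Fintype Q1] [DecidableEq Q0] [DecidableEq Q1]
variable {m : ℕ}

/-- The staircase `ρ• ∈ X•`: at each vertex, its coordinates are
`ν^{(i)} - 1, ν^{(i)} - 2, …, 1, 0` read in the order of the coordinates at that vertex;
equivalently, `ρ x` is the number of coordinates at the vertex of `x` that are greater
than `x`. -/
def rho (iseq : Fin m → Q0) (a : Fin m → ℕ) : Coord m a → ℤ := fun x =>
  ((Finset.univ.filter (fun y : Coord m a => iseq y.1 = iseq x.1 ∧ coordLT x y)).card : ℤ)

/-- The index set `R_{𝐢,𝐚}`: triples (arrow `b`, coordinate `(k,p)`, coordinate `(ℓ,q)`)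
with `k < ℓ`, `tb = i_k` and `hb = i_ℓ`. -/
abbrev RootSet (hd tl : Q1 → Q0) (iseq : Fin m → Q0) (a : Fin m → ℕ) : Type :=
  {z : Q1 × Coord m a × Coord m a //
    z.2.1.1 < z.2.2.1 ∧ tl z.1 = iseq z.2.1.1 ∧ hd z.1 = iseq z.2.2.1}

/-- `ᾱ = e(ℓ)_q − e(k)_p ∈ X•` for a root `α = α^b_{p,q}(k,ℓ)`. -/
def alphaBar {hd tl : Q1 → Q0} {iseq : Fin m → Q0} {a : Fin m → ℕ}
    (z : RootSet hd tl iseq a) : Coord m a → ℤ := fun x =>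
  (if x = z.1.2.2 then 1 else 0) - (if x = z.1.2.1 then 1 else 0)

/-- The group `S• = ∏_i S_{ν^{(i)}}`, realized as permutations of the coordinates
preserving the vertex. -/
abbrev VertexPerm (iseq : Fin m → Q0) (a : Fin m → ℕ) : Type :=
  {σ : Equiv.Perm (Coord m a) // ∀ x : Coord m a, iseq (σ x).1 = iseq x.1}

/-- The quiver Kostka-Shoji polynomial `𝒦^{𝐢,𝐚}_{λ•,μ(•)}(t_{Q₁})`, defined by the signed
sum over `w• ∈ S•` of, for each `w•`, the (finite) sum of the monomials
`∏_α t_α^{m(α)}` over all Kostant partitions `m : R_{𝐢,𝐚} → ℤ_{≥0}` with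
`Σ_α m(α) ᾱ = (w•)⁻¹(λ•+ρ•) − (μ•+ρ•)`. -/
noncomputable def KS (hd tl : Q1 → Q0) (iseq : Fin m → Q0) (a : Fin m → ℕ)
    (lam mu : Coord m a → ℤ) : MvPolynomial Q1 ℤ :=
  ∑ σ : VertexPerm iseq a,
    ((Equiv.Perm.sign σ.1 : ℤˣ) : ℤ) •
      ∑ᶠ f : {f : RootSet hd tl iseq a → ℕ //
          ∀ x : Coord m a,
            (∑ α : RootSet hd tl iseq a, (f α : ℤ) * alphaBar α x)
              = (lam (σ.1 x) + rho iseq a (σ.1 x)) - (mu x + rho iseq a x)},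
        ∏ α : RootSet hd tl iseq a, MvPolynomial.X α.1.1 ^ f.1 α

/-- `μ(•)` is a sequence of weakly decreasing vectors `μ(k) ∈ ℤ^{a_k}`. -/
def BlockDecreasing {a : Fin m → ℕ} (mu : Coord m a → ℤ) : Prop :=
  ∀ (k : Fin m) (p q : Fin (a k)), p ≤ q → mu ⟨k, q⟩ ≤ mu ⟨k, p⟩

/-- `λ•` is a tuple of weakly decreasing vectors `λ^{(i)} ∈ ℤ^{ν^{(i)}}`: weakly decreasing
along the coordinates of each vertex. -/
def VertexDecreasing (iseq : Fin m → Q0) {a : Fin m → ℕ} (lam : Coord m a → ℤ) : Prop :=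
  ∀ x y : Coord m a, iseq x.1 = iseq y.1 → coordLT x y → lam y ≤ lam x

end QKS

namespace QKS

variable {Q0 Q1 : Type} [DecidableEq Q0] {m : ℕ}

theorem sum_comp_vertexPerm (iseq : Fin m → Q0) (a : Fin m → ℕ) (σ : VertexPerm iseq a)
    (g : Coord m a → ℤ) (i : Q0) :
    ∑ x : Coord m a, (if iseq x.1 = i then g (σ.1 x) else 0)
      = ∑ x : Coord m a, (if iseq x.1 = i then g x else 0) := by
  rw [← Equiv.sum_comp σ.1 (fun x : Coord m a => if iseq x.1 = i then g x else 0)]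
  simp only [σ.2]

theorem sum_alphaBar_vertex {hd tl : Q1 → Q0} {iseq : Fin m → Q0} {a : Fin m → ℕ}
    (α : RootSet hd tl iseq a) (i : Q0) :
    ∑ x : Coord m a, (if iseq x.1 = i then alphaBar α x else 0)
      = (if hd α.1.1 = i then 1 else 0) - (if tl α.1.1 = i then 1 else 0) := by
  have hsplit : ∀ x : Coord m a, (if iseq x.1 = i then alphaBar α x else 0)
      = (if x = α.1.2.2 then (if iseq x.1 = i then (1 : ℤ) else 0) else 0)
        - (if x = α.1.2.1 then (if iseq x.1 = i then (1 : ℤ) else 0) else 0) := by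
    intro x
    unfold alphaBar
    split_ifs <;> simp
  simp only [hsplit, Finset.sum_sub_distrib, Finset.sum_ite_eq', Finset.mem_univ, if_true,
    α.2.2.1, α.2.2.2]

variable [Fintype Q1]

/-- The divergence of an exponent vector at a vertex: the exponents of the incoming arrows
minus those of the outgoing arrows. -/
def divergence (hd tl : Q1 → Q0) (d : Q1 →₀ ℕ) (i : Q0) : ℤ :=
  ∑ b : Q1, (d b : ℤ) * ((if hd b = i then 1 else 0) - (if tl b = i then 1 else 0))

/-- The exponent vector of the monomial of a Kostant partition. -/
noncomputable def partitionExponent {hd tl : Q1 → Q0} {iseq : Fin m → Q0} {a : Fin m → ℕ}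
    (f : RootSet hd tl iseq a → ℕ) : Q1 →₀ ℕ :=
  ∑ α : RootSet hd tl iseq a, Finsupp.single α.1.1 (f α)

theorem prod_X_pow_eq_monomial {hd tl : Q1 → Q0} {iseq : Fin m → Q0} {a : Fin m → ℕ}
    (f : RootSet hd tl iseq a → ℕ) :
    ∏ α : RootSet hd tl iseq a, (MvPolynomial.X α.1.1 : MvPolynomial Q1 ℤ) ^ f α
      = MvPolynomial.monomial (partitionExponent f) 1 := by
  simp only [partitionExponent, MvPolynomial.monomial_sum_one, MvPolynomial.X_pow_eq_monomial]

theorem divergence_partitionExponent {hd tl : Q1 → Q0} {iseq : Fin m → Q0} {a : Fin m → ℕ}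
    (f : RootSet hd tl iseq a → ℕ) (i : Q0) :
    divergence hd tl (partitionExponent f) i
      = ∑ x : Coord m a, (if iseq x.1 = i then
          ∑ α : RootSet hd tl iseq a, (f α : ℤ) * alphaBar α x else 0) := by
  have hright : ∑ x : Coord m a, (if iseq x.1 = i then
        ∑ α : RootSet hd tl iseq a, (f α : ℤ) * alphaBar α x else 0)
      = ∑ α : RootSet hd tl iseq a, (f α : ℤ) *
          ((if hd α.1.1 = i then 1 else 0) - (if tl α.1.1 = i then 1 else 0)) := by
    simp only [← sum_alphaBar_vertex, Finset.mul_sum]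
    rw [Finset.sum_comm]
    refine Finset.sum_congr rfl fun x _ => ?_
    split_ifs <;> simp
  rw [hright]
  simp only [divergence, partitionExponent, Finsupp.finsetSum_apply, Nat.cast_sum,
    Finset.sum_mul]
  rw [Finset.sum_comm]
  refine Finset.sum_congr rfl fun α _ => ?_
  rw [Finset.sum_eq_single α.1.1]
  · simp
  · intro b _ hb
    simp [Ne.symm hb]
  · simp

/-- All monomials of a quiver Kostka-Shoji polynomial have the same divergence. -/
theorem divergence_of_mem_support_KS (hd tl : Q1 → Q0) (iseq : Fin m → Q0) (a : Fin m → ℕ)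
    (lam mu : Coord m a → ℤ) {d : Q1 →₀ ℕ} (hdS : d ∈ (KS hd tl iseq a lam mu).support)
    (i : Q0) :
    divergence hd tl d i = ∑ x : Coord m a, (if iseq x.1 = i then
      (lam x + rho iseq a x) - (mu x + rho iseq a x) else 0) := by
  suffices h : KS hd tl iseq a lam mu ∈ MvPolynomial.restrictSupport ℤ
      {d : Q1 →₀ ℕ | divergence hd tl d i = ∑ x : Coord m a, (if iseq x.1 = i then
        (lam x + rho iseq a x) - (mu x + rho iseq a x) else 0)} from
    (MvPolynomial.mem_restrictSupport_iff ℤ).1 h hdS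
  refine Submodule.sum_mem _ fun σ _ => Submodule.smul_mem _ _ ?_
  refine finsum_induction (fun p => p ∈ MvPolynomial.restrictSupport ℤ _) (Submodule.zero_mem _)
    (fun _ _ => Submodule.add_mem _) fun f => ?_
  rw [prod_X_pow_eq_monomial, MvPolynomial.mem_restrictSupport_iff]
  refine fun e he => ?_
  obtain rfl := Finset.mem_singleton.1 (MvPolynomial.support_monomial_subset he)
  have hperm := sum_comp_vertexPerm iseq a σ (fun x => lam x + rho iseq a x) i
  simp only [Set.mem_ofPred_eq, divergence_partitionExponent, f.2]
  have hsub : ∀ (p : Prop) [Decidable p] (u v : ℤ),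
      (if p then u - v else 0) = (if p then u else 0) - (if p then v else 0) := by
    intro p _ u v
    split_ifs <;> simp
  simp only [hsub, Finset.sum_sub_distrib]
  rw [hperm]

theorem divergence_cyclic {r : ℕ} [NeZero r] (d : ZMod r →₀ ℕ) (i : ZMod r) :
    divergence (fun i => i + 1) id d i = d (i - 1) - d i := by
  simp [divergence, mul_sub, Finset.sum_sub_distrib, ← eq_sub_iff_add_eq]

theorem eq_of_forall_sub_one_eq {r : ℕ} [NeZero r] {e : ZMod r → ℤ}
    (h : ∀ i, e (i - 1) = e i) (i j : ZMod r) : e i = e j := by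
  have key : ∀ k : ℕ, e (k : ZMod r) = e 0 := by
    intro k
    induction k with
    | zero => simp
    | succ k ih => rw [← ih, ← h]; simp
  rw [← ZMod.natCast_zmod_val i, ← ZMod.natCast_zmod_val j, key, key]

end QKS

section LaurentMonomial

variable {ι : Type*} [Fintype ι]

/-- Coefficients of a monomial times a polynomial in the product of all variables. -/
theorem MvPolynomial.coeff_monomial_mul_aeval_prod_X (v w : ι →₀ ℕ) (i₀ : ι) (h : v i₀ = w i₀)
    (K : Polynomial ℤ) (j : ℕ) [Decidable (v = w)] :
    MvPolynomial.coeff (w + j • Finsupp.equivFunOnFinite.symm fun _ => 1)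
      (MvPolynomial.monomial v 1 * Polynomial.aeval (∏ i : ι, MvPolynomial.X i) K)
      = if v = w then K.coeff j else 0 := by
  classical
  have hprod : (∏ i : ι, MvPolynomial.X i : MvPolynomial ι ℤ)
      = MvPolynomial.monomial (Finsupp.equivFunOnFinite.symm fun _ => 1) 1 := by
    rw [MvPolynomial.monomial_eq, Finsupp.prod_fintype _ _ (by simp)]
    simp
  have hexp : ∀ k : ℕ, v + k • (Finsupp.equivFunOnFinite.symm fun _ : ι => 1)
      = w + j • (Finsupp.equivFunOnFinite.symm fun _ => 1) ↔ k = j ∧ v = w := by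
    intro k
    constructor
    · intro hk
      have hkj : k = j := by
        have := DFunLike.congr_fun hk i₀
        simp at this
        omega
      subst hkj
      exact ⟨rfl, add_right_cancel hk⟩
    · rintro ⟨rfl, rfl⟩
      rfl
  rw [hprod, Polynomial.aeval_eq_sum_range, Finset.mul_sum, MvPolynomial.coeff_sum]
  simp only [MvPolynomial.monomial_pow, one_pow, mul_smul_comm, MvPolynomial.monomial_mul,
    MvPolynomial.coeff_smul, MvPolynomial.coeff_monomial, hexp, mul_one, smul_eq_mul]
  by_cases hvw : v = w
  · simp only [hvw, and_true, mul_ite, mul_one, mul_zero, if_true, Finset.sum_ite_eq',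
      Finset.mem_range]
    split_ifs with hj
    · rfl
    · exact (Polynomial.coeff_eq_zero_of_natDegree_lt (by omega)).symm
  · simp [hvw]

variable {F : Type*} [Field F] [Algebra (MvPolynomial ι ℤ) F]
  [IsFractionRing (MvPolynomial ι ℤ) F]

/-- A nonzero Laurent monomial without the variable `i₀`, times a polynomial in the product of
all variables, determines both factors. -/
theorem laurentMonomial_mul_aeval_prod_X_injective (i₀ : ι) {c c' : ι → ℤ} {K K' : Polynomial ℤ}
    (hc : c i₀ = 0) (hc' : c' i₀ = 0) (hK : K ≠ 0)
    (h : (∏ i, algebraMap (MvPolynomial ι ℤ) F (MvPolynomial.X i) ^ c i)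
        * Polynomial.aeval (∏ i, algebraMap (MvPolynomial ι ℤ) F (MvPolynomial.X i)) K
      = (∏ i, algebraMap (MvPolynomial ι ℤ) F (MvPolynomial.X i) ^ c' i)
        * Polynomial.aeval (∏ i, algebraMap (MvPolynomial ι ℤ) F (MvPolynomial.X i)) K') :
    c' = c ∧ K' = K := by
  classical
  have hX : ∀ i, algebraMap (MvPolynomial ι ℤ) F (MvPolynomial.X i) ≠ 0 := fun i =>
    (map_ne_zero_iff _ (IsFractionRing.injective _ F)).2 (MvPolynomial.X_ne_zero i)
  let s : ι → ℕ := fun i => (c i).natAbs + (c' i).natAbs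
  let shift : (ι → ℤ) → ι →₀ ℕ := fun c =>
    Finsupp.equivFunOnFinite.symm fun i => (c i + s i).toNat
  have hshift : ∀ (e : ι → ℤ) (L : Polynomial ℤ), (∀ i, 0 ≤ e i + s i) →
      algebraMap (MvPolynomial ι ℤ) F (MvPolynomial.monomial (shift e) 1
          * Polynomial.aeval (∏ i : ι, MvPolynomial.X i) L)
        = (∏ i, algebraMap (MvPolynomial ι ℤ) F (MvPolynomial.X i) ^ s i) *
          ((∏ i, algebraMap (MvPolynomial ι ℤ) F (MvPolynomial.X i) ^ e i)
            * Polynomial.aeval (∏ i, algebraMap (MvPolynomial ι ℤ) F (MvPolynomial.X i)) L) := by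
    intro e L he
    rw [map_mul, ← mul_assoc, ← Finset.prod_mul_distrib]
    congr 1
    · rw [MvPolynomial.monomial_eq, Finsupp.prod_fintype _ _ (by simp)]
      simp only [map_one, one_mul, map_prod, map_pow]
      refine Finset.prod_congr rfl fun i _ => ?_
      rw [← zpow_natCast, ← zpow_natCast, ← zpow_add₀ (hX i)]
      congr 1
      simp only [shift, Finsupp.equivFunOnFinite_symm_apply_apply]
      rw [Int.toNat_of_nonneg (he i), add_comm]
    · rw [← map_prod, Polynomial.aeval_algebraMap_apply]
  have hpoly : (MvPolynomial.monomial (shift c) 1 : MvPolynomial ι ℤ)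
        * Polynomial.aeval (∏ i, MvPolynomial.X i) K
      = MvPolynomial.monomial (shift c') 1 * Polynomial.aeval (∏ i, MvPolynomial.X i) K' := by
    apply IsFractionRing.injective (MvPolynomial ι ℤ) F
    rw [hshift c K fun i => by grind, hshift c' K' fun i => by grind, h]
  have hcoeff : ∀ j, K.coeff j = if shift c' = shift c then K'.coeff j else 0 := by
    intro j
    rw [← MvPolynomial.coeff_monomial_mul_aeval_prod_X (shift c') (shift c) i₀
      (by simp [shift, hc, hc']) K' j, ← hpoly,
      MvPolynomial.coeff_monomial_mul_aeval_prod_X (shift c) (shift c) i₀ rfl, if_pos rfl]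
  obtain ⟨j, hj⟩ : ∃ j, K.coeff j ≠ 0 := by
    by_contra! hzero
    exact hK (Polynomial.ext fun j => by simpa using hzero j)
  have heq : shift c' = shift c := by
    by_contra hne
    exact hj (by rw [hcoeff, if_neg hne])
  refine ⟨funext fun i => ?_, Polynomial.ext fun j => ?_⟩
  · have := DFunLike.congr_fun heq i
    simp only [shift, s, Finsupp.equivFunOnFinite_symm_apply_apply] at this
    omega
  · rw [hcoeff, if_pos heq]

/-- A polynomial all of whose exponent vectors are translates of `c` by constant vectors is a
Laurent monomial times a polynomial in the product of all variables. -/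
theorem algebraMap_eq_laurentMonomial_mul_aeval_prod_X (i₀ : ι) (c : ι → ℤ)
    (P : MvPolynomial ι ℤ) (hP : ∀ d ∈ P.support, ∀ i, (d i : ℤ) = c i + d i₀) :
    algebraMap (MvPolynomial ι ℤ) F P
      = (∏ i, algebraMap (MvPolynomial ι ℤ) F (MvPolynomial.X i) ^ c i)
        * Polynomial.aeval (∏ i, algebraMap (MvPolynomial ι ℤ) F (MvPolynomial.X i))
          (∑ d ∈ P.support, Polynomial.monomial (d i₀) (P.coeff d)) := by
  have hX : ∀ i, algebraMap (MvPolynomial ι ℤ) F (MvPolynomial.X i) ≠ 0 := fun i =>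
    (map_ne_zero_iff _ (IsFractionRing.injective _ F)).2 (MvPolynomial.X_ne_zero i)
  conv_lhs => rw [MvPolynomial.as_sum P]
  rw [map_sum, map_sum, Finset.mul_sum]
  refine Finset.sum_congr rfl fun d hdP => ?_
  rw [MvPolynomial.monomial_eq, Finsupp.prod_fintype _ _ (by simp), Polynomial.aeval_monomial,
    mul_left_comm, map_mul, map_prod, ← Finset.prod_pow, ← Finset.prod_mul_distrib]
  congr 1
  · simp
  · refine Finset.prod_congr rfl fun i _ => ?_
    rw [map_pow, ← zpow_natCast, ← zpow_natCast, ← zpow_add₀ (hX i), hP d hdP i]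

end LaurentMonomial

open QKS in
/-- for the cyclic quiver with `r = n + 2 ≥ 2` vertices `ℤ/rℤ` and one arrow
`i → i+1` (with variable `t_{i,i+1}`) for each `i`, there exist exponents
`a_i ∈ ℤ` (for `i = 0, …, r−2`, i.e. vanishing at the arrow out of `r−1 = -1`) and a
polynomial `𝒦^red ∈ ℤ[t]` with
`𝒦^{𝐢,𝐚}_{λ•,μ(•)} = (∏_{i=0}^{r-2} t_{i,i+1}^{a_i}) · 𝒦^red(t_{01}t_{12}⋯t_{r-1,0})`
(an identity of Laurent polynomials, read in the fraction field); moreover if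
`𝒦^{𝐢,𝐚}_{λ•,μ(•)} ≠ 0` then the Laurent monomial and `𝒦^red` are unique. -/
theorem stmt_9
    (n : ℕ)
    -- the cyclic quiver on `r = n + 2` vertices: `Q₀ = Q₁ = ℤ/rℤ`, the arrow labelled `i`
    -- goes from `i` to `i + 1`
    (hd tl : ZMod (n + 2) → ZMod (n + 2)) (hhd : hd = fun i => i + 1) (htl : tl = id)
    (m : ℕ) (iseq : Fin m → ZMod (n + 2)) (a : Fin m → ℕ) (ha : ∀ k, 0 < a k)
    (mu : Coord m a → ℤ) (hmu : BlockDecreasing mu)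
    (lam : Coord m a → ℤ) (hlam : VertexDecreasing iseq lam)
    -- the ambient field of rational functions in the arrow variables, in which Laurent
    -- monomials with integer exponents make sense
    (F : Type) [Field F] [Algebra (MvPolynomial (ZMod (n + 2)) ℤ) F]
    [IsFractionRing (MvPolynomial (ZMod (n + 2)) ℤ) F] :
    ∃ (c : ZMod (n + 2) → ℤ) (Kred : Polynomial ℤ),
      (c (-1) = 0 ∧
        algebraMap (MvPolynomial (ZMod (n + 2)) ℤ) F (KS hd tl iseq a lam mu)
          = (∏ i : ZMod (n + 2),
                (algebraMap (MvPolynomial (ZMod (n + 2)) ℤ) F (MvPolynomial.X i)) ^ (c i))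
            * Polynomial.aeval
                (∏ i : ZMod (n + 2),
                  algebraMap (MvPolynomial (ZMod (n + 2)) ℤ) F (MvPolynomial.X i))
                Kred) ∧
      (KS hd tl iseq a lam mu ≠ 0 →
        ∀ (c' : ZMod (n + 2) → ℤ) (Kred' : Polynomial ℤ),
          (c' (-1) = 0 ∧
            algebraMap (MvPolynomial (ZMod (n + 2)) ℤ) F (KS hd tl iseq a lam mu)
              = (∏ i : ZMod (n + 2),
                    (algebraMap (MvPolynomial (ZMod (n + 2)) ℤ) F (MvPolynomial.X i)) ^ (c' i))
                * Polynomial.aeval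
                    (∏ i : ZMod (n + 2),
                      algebraMap (MvPolynomial (ZMod (n + 2)) ℤ) F (MvPolynomial.X i))
                    Kred') →
          c' = c ∧ Kred' = Kred) := by
  subst hhd htl
  obtain ⟨c, hc, hsupp⟩ : ∃ c : ZMod (n + 2) → ℤ, c (-1) = 0 ∧
      ∀ d ∈ (KS (fun i => i + 1) id iseq a lam mu).support, ∀ i, (d i : ℤ) = c i + d (-1) := by
    rcases (KS (fun i => i + 1) id iseq a lam mu).support.eq_empty_or_nonempty with h0 | ⟨d₀, hd₀⟩
    · exact ⟨0, rfl, by simp [h0]⟩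
    · refine ⟨fun i => d₀ i - d₀ (-1), by simp, fun d hdS i => ?_⟩
      have hconst := eq_of_forall_sub_one_eq (e := fun i => (d i : ℤ) - d₀ i) (fun j => by
        have h := divergence_of_mem_support_KS _ _ iseq a lam mu hdS j
        rw [← divergence_of_mem_support_KS _ _ iseq a lam mu hd₀ j, divergence_cyclic,
          divergence_cyclic] at h
        linarith) i (-1)
      linarith
  have hrepr := algebraMap_eq_laurentMonomial_mul_aeval_prod_X (F := F) (-1) c _ hsupp
  refine ⟨c, _, ⟨hc, hrepr⟩, fun hne c' Kred' hc' => ?_⟩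
  refine laurentMonomial_mul_aeval_prod_X_injective (F := F) (-1) hc hc'.1 (fun h0 => hne ?_)
    (hrepr.symm.trans hc'.2)
  rw [h0, map_zero, mul_zero] at hrepr
  exact IsFractionRing.injective _ F (hrepr.trans (map_zero _).symm)
end

section
/- The shuffle product * is well defined and associative: for f, g, h symmetric Laurent polynomials as above in three pairwise disjoint sets of variables for dimension vectors α•, β•, γ•, the product f * g is again a Laurent polynomial symmetric in the variables at each vertex, and (f * g) * h = f * (g * h) as Laurent polynomials in the combined variables for the dimension vector α• + β• + γ•. -/
open scoped BigOperators

namespace Shuffle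

noncomputable section

/-- The field of rational functions in the variables indexed by `V`: the fraction field of
the multivariate polynomial ring.  Laurent polynomials in the variables `X v` are viewed
inside this field, and the geometric series `(1 - t·x/y)⁻¹` is the honest inverse here. -/
abbrev FF (V : Type) : Type := FractionRing (MvPolynomial V ℚ)

/-- The variable `X v`, viewed in the rational function field. -/
def xv {V : Type} (v : V) : FF V := algebraMap (MvPolynomial V ℚ) (FF V) (MvPolynomial.X v)

/-- The action of a permutation of the variables on the rational function field,
by renaming variables. -/
def act {V : Type} (σ : Equiv.Perm V) : FF V →+* FF V :=
  IsFractionRing.lift (g := (algebraMap (MvPolynomial V ℚ) (FF V)).comp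
      (MvPolynomial.rename σ : MvPolynomial V ℚ →ₐ[ℚ] MvPolynomial V ℚ).toRingHom)
    ((IsFractionRing.injective (MvPolynomial V ℚ) (FF V)).comp
      (MvPolynomial.rename_injective σ σ.injective))

variable {X Q0 Q1 : Type} [Fintype X] [DecidableEq X] [Fintype Q0] [DecidableEq Q0]
  [Fintype Q1] [DecidableEq Q1]

/-- The `x`-variable indexed by `x : X`, inside the field of rational functions in
the `x`-variables and the arrow variables. -/
def xx (Q1 : Type) (x : X) : FF (X ⊕ Q1) := xv (Sum.inl x)

/-- The arrow variable `t_b`. -/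
def tt (X : Type) (b : Q1) : FF (X ⊕ Q1) := xv (Sum.inr b)

/-- Extension of a permutation of the `x`-variables by the identity on the arrow
variables. -/
def permExt (Q1 : Type) (σ : Equiv.Perm X) : Equiv.Perm (X ⊕ Q1) :=
  Equiv.sumCongr σ (Equiv.refl Q1)

/-- The monomial `x^β` with integer exponents. -/
def xmon (Q1 : Type) (β : X → ℤ) : FF (X ⊕ Q1) := ∏ x : X, (xx Q1 x) ^ (β x)

/-- The staircase exponent for the variables in `S`: each variable `x ∈ S` gets the number
of variables in `S` at the same vertex that come after it (so at each vertex the variables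
of `S` receive `ν - 1, ν - 2, …, 1, 0` in their listed order). -/
def rhoS (vert : X → Q0) (lt : X → X → Prop) [DecidableRel lt] (S : Finset X) : X → ℤ :=
  fun x => if x ∈ S then ((S.filter (fun y => vert y = vert x ∧ lt x y)).card : ℤ) else 0

/-- The antisymmetrizer `J• = Σ (−1)^{w•} w•` over the permutations of the variables in `S`
preserving the vertex of each variable (and fixing all other variables). -/
def Jsym (vert : X → Q0) (S : Finset X) (f : FF (X ⊕ Q1)) : FF (X ⊕ Q1) :=
  ∑ σ ∈ Finset.univ.filter (fun σ : Equiv.Perm X =>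
      (∀ x, vert (σ x) = vert x) ∧ ∀ x ∉ S, σ x = x),
    ((Equiv.Perm.sign σ : ℤˣ) : ℤ) • act (permExt Q1 σ) f

/-- The Demazure symmetrizer `D_{w₀•}(f) = J•(x^{ρ•})⁻¹ · J•(x^{ρ•} f)` over the variables
in `S`, symmetrizing at each vertex. -/
def Dem (vert : X → Q0) (lt : X → X → Prop) [DecidableRel lt] (S : Finset X)
    (f : FF (X ⊕ Q1)) : FF (X ⊕ Q1) :=
  (Jsym vert S (xmon Q1 (rhoS vert lt S)))⁻¹ * Jsym vert S (xmon Q1 (rhoS vert lt S) * f)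

/-- The subring of Laurent polynomials over `ℤ[t_b^{±1} : b ∈ Q₁]` in the `x`-variables
belonging to `S`. -/
def LaurentIn (Q1 : Type) [Fintype Q1] (S : Finset X) : Subring (FF (X ⊕ Q1)) :=
  Subring.closure
    ((fun x : X => xx Q1 x) '' ↑S ∪ (fun x : X => (xx Q1 x)⁻¹) '' ↑S
      ∪ Set.range (tt X (Q1 := Q1)) ∪ Set.range (fun b : Q1 => (tt X b)⁻¹))

/-- `f` is symmetric in the variables of `S` at each vertex. -/
def SymmOn (Q1 : Type) (vert : X → Q0) (S : Finset X) (f : FF (X ⊕ Q1)) : Prop :=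
  ∀ σ : Equiv.Perm X, (∀ x, vert (σ x) = vert x) → (∀ x ∉ S, σ x = x) →
    act (permExt Q1 σ) f = f

/-- The shuffle product `f * g` of `f` (in the variables of `A`) and `g` (in the variables
of `B`): `D_{w₀•}(f · g · ∏_b ∏_{y ∈ B, vert y = tb} ∏_{x ∈ A, vert x = hb}
(1 − t_b y/x))`. -/
def starMul (vert : X → Q0) (hd tl : Q1 → Q0) (lt : X → X → Prop) [DecidableRel lt]
    (A B : Finset X) (f g : FF (X ⊕ Q1)) : FF (X ⊕ Q1) :=
  Dem vert lt (A ∪ B) (f * g *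
    ∏ b : Q1, ∏ y ∈ B.filter (fun y => vert y = tl b), ∏ x ∈ A.filter (fun x => vert x = hd b),
      (1 - tt X b * xx Q1 y / xx Q1 x))

/-- The shuffle product `f ⋆ g` of `f` (in the variables of `A`) and `g` (in the variables
of `B`): `D_{w₀•}(f · g · ∏_b ∏_{x ∈ A, vert x = tb} ∏_{y ∈ B, vert y = hb}
(1 − t_b x/y)⁻¹)`. -/
def starGeom (vert : X → Q0) (hd tl : Q1 → Q0) (lt : X → X → Prop) [DecidableRel lt]
    (A B : Finset X) (f g : FF (X ⊕ Q1)) : FF (X ⊕ Q1) :=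
  Dem vert lt (A ∪ B) (f * g *
    ∏ b : Q1, ∏ x ∈ A.filter (fun x => vert x = tl b), ∏ y ∈ B.filter (fun y => vert y = hd b),
      (1 - tt X b * xx Q1 x / xx Q1 y)⁻¹)

end

end Shuffle

set_option linter.unusedSectionVars false

namespace Shuffle

section Action

variable {V : Type}

lemma act_algebraMap (σ : Equiv.Perm V) (p : MvPolynomial V ℚ) :
    act σ (algebraMap _ (FF V) p) = algebraMap _ (FF V) (MvPolynomial.rename σ p) := by
  unfold act
  rw [IsFractionRing.lift_algebraMap]
  rfl

lemma act_xv (σ : Equiv.Perm V) (v : V) : act σ (xv v) = xv (σ v) := by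
  simp [xv, act_algebraMap]

lemma act_mul (σ τ : Equiv.Perm V) (f : FF V) : act (σ * τ) f = act σ (act τ f) := by
  obtain ⟨p, q, -, rfl⟩ := IsFractionRing.div_surjective (A := MvPolynomial V ℚ) f
  simp [act_algebraMap, MvPolynomial.rename_rename, map_div₀, Equiv.Perm.coe_mul]

lemma xv_ne_zero (v : V) : xv v ≠ 0 := by
  simp [xv]

end Action

section Symmetrizer

variable {X Q0 Q1 : Type}

lemma permExt_mul (σ τ : Equiv.Perm X) :
    permExt Q1 (σ * τ) = permExt Q1 σ * permExt Q1 τ := by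
  ext (x | b) <;> rfl

lemma act_xx (σ : Equiv.Perm X) (x : X) : act (permExt Q1 σ) (xx Q1 x) = xx Q1 (σ x) := by
  simp [xx, act_xv, permExt]

lemma act_tt (σ : Equiv.Perm X) (b : Q1) : act (permExt Q1 σ) (tt X b) = tt X b := by
  simp [tt, act_xv, permExt]

lemma xx_ne_zero (x : X) : xx Q1 x ≠ 0 := xv_ne_zero _

lemma tt_ne_zero (b : Q1) : tt X b ≠ 0 := xv_ne_zero _

/-- The permutations of the variables in `S` preserving the vertex of each variable. -/
def youngGroup (vert : X → Q0) (S : Finset X) : Subgroup (Equiv.Perm X) where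
  carrier := {σ | (∀ x, vert (σ x) = vert x) ∧ ∀ x ∉ S, σ x = x}
  mul_mem' {σ τ} hσ hτ := ⟨fun x => by simp [hσ.1, hτ.1], fun x hx => by
    simp [hτ.2 x hx, hσ.2 x hx]⟩
  one_mem' := by simp
  inv_mem' {σ} hσ := ⟨fun x => by simpa using (hσ.1 (σ⁻¹ x)).symm, fun x hx => by
    rw [Equiv.Perm.inv_eq_iff_eq, hσ.2 x hx]⟩

lemma youngGroup_mono {vert : X → Q0} {S T : Finset X} (h : T ⊆ S) :
    youngGroup vert T ≤ youngGroup vert S :=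
  fun _ hσ => ⟨hσ.1, fun x hx => hσ.2 x fun hxT => hx (h hxT)⟩

lemma apply_mem_iff {vert : X → Q0} {S T : Finset X} {σ : Equiv.Perm X}
    (hσ : σ ∈ youngGroup vert T) (hTS : T ⊆ S ∨ Disjoint T S) (x : X) : σ x ∈ S ↔ x ∈ S := by
  by_cases hx : x ∈ T
  · have hσx : σ x ∈ T := by
      by_contra hn
      exact hn (by rwa [σ.injective (hσ.2 _ hn)])
    rcases hTS with h | h
    · exact ⟨fun _ => h hx, fun _ => h hσx⟩
    · exact ⟨fun h' => absurd h' (Finset.disjoint_left.1 h hσx),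
        fun h' => absurd h' (Finset.disjoint_left.1 h hx)⟩
  · rw [hσ.2 x hx]

variable [Fintype X] [DecidableEq X] [DecidableEq Q0]

instance decidableMemYoungGroup (vert : X → Q0) (S : Finset X) :
    DecidablePred (· ∈ youngGroup vert S) :=
  inferInstanceAs (DecidablePred fun σ : Equiv.Perm X =>
    (∀ x, vert (σ x) = vert x) ∧ ∀ x ∉ S, σ x = x)

lemma Jsym_eq (vert : X → Q0) (S : Finset X) (f : FF (X ⊕ Q1)) :
    Jsym vert S f = ∑ σ with σ ∈ youngGroup vert S,
      ((Equiv.Perm.sign σ : ℤˣ) : ℤ) • act (permExt Q1 σ) f := rfl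

lemma act_Jsym {vert : X → Q0} {S : Finset X} {τ : Equiv.Perm X} (hτ : τ ∈ youngGroup vert S)
    (f : FF (X ⊕ Q1)) :
    act (permExt Q1 τ) (Jsym vert S f) = ((Equiv.Perm.sign τ : ℤˣ) : ℤ) • Jsym vert S f := by
  simp only [Jsym_eq, map_sum, Finset.smul_sum, map_zsmul]
  refine Finset.sum_equiv (Equiv.mulLeft τ) (fun σ => ?_) fun σ _ => ?_
  · simp [Subgroup.mul_mem_cancel_left _ hτ]
  · rw [Equiv.coe_mulLeft, permExt_mul, act_mul, smul_smul, map_mul, Units.val_mul, ← mul_assoc,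
      ← Units.val_mul, Int.units_mul_self, Units.val_one, one_mul]

lemma Jsym_act {vert : X → Q0} {S : Finset X} {τ : Equiv.Perm X} (hτ : τ ∈ youngGroup vert S)
    (f : FF (X ⊕ Q1)) :
    Jsym vert S (act (permExt Q1 τ) f) = ((Equiv.Perm.sign τ : ℤˣ) : ℤ) • Jsym vert S f := by
  simp only [Jsym_eq, Finset.smul_sum]
  refine Finset.sum_equiv (Equiv.mulRight τ) (fun σ => ?_) fun σ _ => ?_
  · simp [Subgroup.mul_mem_cancel_right _ hτ]
  · rw [Equiv.coe_mulRight, permExt_mul, act_mul, smul_smul, map_mul, Units.val_mul,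
      mul_comm (Units.val (Equiv.Perm.sign σ)), ← mul_assoc,
      ← Units.val_mul, Int.units_mul_self, Units.val_one, one_mul]

/-- `f` is invariant under the permutations of the variables of `S` at each vertex. -/
lemma symmOn_iff {vert : X → Q0} {S : Finset X} {f : FF (X ⊕ Q1)} :
    SymmOn Q1 vert S f ↔ ∀ σ ∈ youngGroup vert S, act (permExt Q1 σ) f = f :=
  ⟨fun h σ hσ => h σ hσ.1 hσ.2, fun h σ h₁ h₂ => h σ ⟨h₁, h₂⟩⟩

lemma SymmOn.mul {vert : X → Q0} {S : Finset X} {f g : FF (X ⊕ Q1)}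
    (hf : SymmOn Q1 vert S f) (hg : SymmOn Q1 vert S g) : SymmOn Q1 vert S (f * g) :=
  fun σ h₁ h₂ => by rw [map_mul, hf σ h₁ h₂, hg σ h₁ h₂]

lemma Jsym_mul_of_symmOn {vert : X → Q0} {S : Finset X} {H : FF (X ⊕ Q1)}
    (hH : SymmOn Q1 vert S H) (f : FF (X ⊕ Q1)) :
    Jsym vert S (f * H) = Jsym vert S f * H := by
  simp only [Jsym_eq, Finset.sum_mul]
  refine Finset.sum_congr rfl fun σ hσ => ?_
  rw [map_mul, symmOn_iff.1 hH σ (by simpa using hσ), smul_mul_assoc]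

lemma Jsym_Jsym {vert : X → Q0} {S T : Finset X} (hTS : T ⊆ S) (f : FF (X ⊕ Q1)) :
    Jsym vert S (Jsym vert T f) =
      (Finset.card {σ : Equiv.Perm X | σ ∈ youngGroup vert T} : ℕ) • Jsym vert S f := by
  have hadd : ∀ (s : Finset (Equiv.Perm X)) (F : Equiv.Perm X → FF (X ⊕ Q1)),
      Jsym vert S (∑ σ ∈ s, F σ) = ∑ σ ∈ s, Jsym vert S (F σ) := fun s F => by
    simp only [Jsym_eq, map_sum, Finset.smul_sum]
    exact Finset.sum_comm
  have hsmul : ∀ (n : ℤ) (F : FF (X ⊕ Q1)), Jsym vert S (n • F) = n • Jsym vert S F :=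
    fun n F => by
      simp only [Jsym_eq, map_zsmul, Finset.smul_sum]
      exact Finset.sum_congr rfl fun _ _ => smul_comm _ _ _
  rw [Jsym_eq vert T, hadd, ← Finset.sum_const]
  refine Finset.sum_congr rfl fun σ hσ => ?_
  rw [hsmul, Jsym_act (youngGroup_mono hTS (by simpa using hσ)), smul_smul, ← Units.val_mul,
    Int.units_mul_self, Units.val_one, one_smul]

lemma symmOn_Dem (vert : X → Q0) (lt : X → X → Prop) [DecidableRel lt] (S : Finset X)
    (f : FF (X ⊕ Q1)) : SymmOn Q1 vert S (Dem vert lt S f) := by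
  refine symmOn_iff.2 fun σ hσ => ?_
  rw [Dem, map_mul, map_inv₀, act_Jsym hσ, act_Jsym hσ]
  rcases Int.units_eq_one_or (Equiv.Perm.sign σ) with h | h <;> simp [h, inv_neg]

lemma xmon_add (β γ : X → ℤ) : xmon Q1 (β + γ) = xmon Q1 β * xmon Q1 γ := by
  simp only [xmon, ← Finset.prod_mul_distrib, Pi.add_apply]
  exact Finset.prod_congr rfl fun x _ => zpow_add₀ (xx_ne_zero x) _ _

lemma symmOn_xmon {vert : X → Q0} {S : Finset X} {β : X → ℤ}
    (hβ : ∀ σ ∈ youngGroup vert S, ∀ x, β (σ x) = β x) : SymmOn Q1 vert S (xmon Q1 β) := by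
  refine symmOn_iff.2 fun σ hσ => ?_
  simp only [xmon, map_prod, map_zpow₀, act_xx]
  exact Fintype.prod_equiv σ _ _ fun x => by rw [hβ σ hσ]

/-- Absorption of a Demazure symmetrizer by a larger one. -/
lemma Dem_Dem_mul {vert : X → Q0} {lt : X → X → Prop} [DecidableRel lt] {S T : Finset X}
    (hTS : T ⊆ S) {H : FF (X ⊕ Q1)} (hH : SymmOn Q1 vert T H)
    (hρ : SymmOn Q1 vert T (xmon Q1 (rhoS vert lt S - rhoS vert lt T)))
    (hT : Jsym vert T (xmon Q1 (rhoS vert lt T)) ≠ 0) (F : FF (X ⊕ Q1)) :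
    Dem vert lt S (Dem vert lt T F * H) = Dem vert lt S (F * H) := by
  have hsplit : xmon Q1 (rhoS vert lt S) =
      xmon Q1 (rhoS vert lt T) * xmon Q1 (rhoS vert lt S - rhoS vert lt T) := by
    rw [← xmon_add, add_sub_cancel]
  set M := xmon Q1 (rhoS vert lt S - rhoS vert lt T)
  have hJ : Jsym vert T (xmon Q1 (rhoS vert lt S) * (Dem vert lt T F * H)) =
      Jsym vert T (xmon Q1 (rhoS vert lt S) * (F * H)) := by
    rw [hsplit, mul_assoc, Jsym_mul_of_symmOn (hρ.mul ((symmOn_Dem vert lt T F).mul hH)),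
      show xmon Q1 (rhoS vert lt T) * M * (F * H) = xmon Q1 (rhoS vert lt T) * F * (M * H) by ring,
      Jsym_mul_of_symmOn (hρ.mul hH), Dem]
    field_simp
  have hS := congrArg (Jsym vert S) hJ
  rw [Jsym_Jsym hTS, Jsym_Jsym hTS, nsmul_eq_mul, nsmul_eq_mul] at hS
  refine congrArg ((Jsym vert S (xmon Q1 (rhoS vert lt S)))⁻¹ * ·) (mul_left_cancel₀ ?_ hS)
  exact Nat.cast_ne_zero.2 (Finset.card_ne_zero_of_mem (a := 1) (by simp [one_mem]))

lemma rhoS_sub_apply {vert : X → Q0} {lt : X → X → Prop} [DecidableRel lt] {S T : Finset X}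
    (hTS : T ⊆ S) (hlt : ∀ y ∈ S \ T, ∀ x ∈ T, ∀ x' ∈ T, lt x y → lt x' y)
    {σ : Equiv.Perm X} (hσ : σ ∈ youngGroup vert T) (x : X) :
    (rhoS vert lt S - rhoS vert lt T) (σ x) = (rhoS vert lt S - rhoS vert lt T) x := by
  by_cases hx : x ∈ T
  · have hσx : σ x ∈ T := (apply_mem_iff hσ (.inl subset_rfl) x).2 hx
    have key : ∀ z ∈ T, (rhoS vert lt S - rhoS vert lt T) z =
        (((S \ T).filter fun y => vert y = vert z ∧ lt z y).card : ℤ) := fun z hz => by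
      simp only [Pi.sub_apply, rhoS, if_pos hz, if_pos (hTS hz)]
      rw [sub_eq_iff_eq_add, ← Nat.cast_add, ← Finset.card_union_of_disjoint
        (Finset.disjoint_filter_filter Finset.sdiff_disjoint), ← Finset.filter_union,
        Finset.sdiff_union_of_subset hTS]
    rw [key x hx, key _ hσx]
    congr 2
    refine Finset.filter_congr fun y hy => ?_
    rw [hσ.1 x]
    exact and_congr_right fun _ => ⟨hlt y hy _ hσx _ hx, hlt y hy _ hx _ hσx⟩
  · rw [hσ.2 x hx]

end Symmetrizer

section Kernel

variable {X Q0 Q1 : Type} [Fintype X] [DecidableEq X] [DecidableEq Q0] [Fintype Q1]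

/-- The kernel `∏_b ∏_{y ∈ B, vert y = tb} ∏_{x ∈ A, vert x = hb} (1 − t_b y/x)` of the
shuffle product. -/
noncomputable def kernelProd (vert : X → Q0) (hd tl : Q1 → Q0) (A B : Finset X) : FF (X ⊕ Q1) :=
  ∏ b : Q1, ∏ y ∈ B.filter (fun y => vert y = tl b), ∏ x ∈ A.filter (fun x => vert x = hd b),
    (1 - tt X b * xx Q1 y / xx Q1 x)

lemma starMul_eq (vert : X → Q0) (hd tl : Q1 → Q0) (lt : X → X → Prop) [DecidableRel lt]
    (A B : Finset X) (f g : FF (X ⊕ Q1)) :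
    starMul vert hd tl lt A B f g =
      Dem vert lt (A ∪ B) (f * g * kernelProd vert hd tl A B) := rfl

lemma kernelProd_union_left (vert : X → Q0) (hd tl : Q1 → Q0) {A B : Finset X}
    (hAB : Disjoint A B) (C : Finset X) :
    kernelProd vert hd tl (A ∪ B) C = kernelProd vert hd tl A C * kernelProd vert hd tl B C := by
  simp only [kernelProd, ← Finset.prod_mul_distrib]
  refine Finset.prod_congr rfl fun b _ => Finset.prod_congr rfl fun y _ => ?_
  rw [Finset.filter_union, Finset.prod_union (Finset.disjoint_filter_filter hAB)]

lemma kernelProd_union_right (vert : X → Q0) (hd tl : Q1 → Q0) (A : Finset X) {B C : Finset X}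
    (hBC : Disjoint B C) :
    kernelProd vert hd tl A (B ∪ C) = kernelProd vert hd tl A B * kernelProd vert hd tl A C := by
  simp only [kernelProd, ← Finset.prod_mul_distrib]
  refine Finset.prod_congr rfl fun b _ => ?_
  rw [Finset.filter_union, Finset.prod_union (Finset.disjoint_filter_filter hBC)]

lemma symmOn_kernelProd (vert : X → Q0) (hd tl : Q1 → Q0) {A B T : Finset X}
    (hA : T ⊆ A ∨ Disjoint T A) (hB : T ⊆ B ∨ Disjoint T B) :
    SymmOn Q1 vert T (kernelProd vert hd tl A B) := by
  refine symmOn_iff.2 fun σ hσ => ?_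
  simp only [kernelProd, map_prod, map_sub, map_one, map_div₀, map_mul, act_xx, act_tt]
  refine Finset.prod_congr rfl fun b _ => ?_
  refine Finset.prod_equiv σ (fun y => ?_) fun y _ => Finset.prod_equiv σ (fun x => ?_)
    fun x _ => rfl
  · simp [apply_mem_iff hσ hB, hσ.1]
  · simp [apply_mem_iff hσ hA, hσ.1]

lemma xx_mem {S : Finset X} {x : X} (hx : x ∈ S) : xx Q1 x ∈ LaurentIn Q1 S :=
  Subring.subset_closure (.inl (.inl (.inl ⟨x, hx, rfl⟩)))

lemma xx_inv_mem {S : Finset X} {x : X} (hx : x ∈ S) : (xx Q1 x)⁻¹ ∈ LaurentIn Q1 S :=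
  Subring.subset_closure (.inl (.inl (.inr ⟨x, hx, rfl⟩)))

lemma tt_mem (S : Finset X) (b : Q1) : tt X b ∈ LaurentIn Q1 S :=
  Subring.subset_closure (.inl (.inr ⟨b, rfl⟩))

lemma tt_inv_mem (S : Finset X) (b : Q1) : (tt X b)⁻¹ ∈ LaurentIn Q1 S :=
  Subring.subset_closure (.inr ⟨b, rfl⟩)

lemma LaurentIn_mono {S T : Finset X} (h : S ⊆ T) : LaurentIn Q1 S ≤ LaurentIn Q1 T := by
  refine Subring.closure_mono ?_
  gcongr

lemma kernelProd_mem (vert : X → Q0) (hd tl : Q1 → Q0) (A B : Finset X) :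
    kernelProd vert hd tl A B ∈ LaurentIn Q1 (A ∪ B) := by
  refine prod_mem fun b _ => prod_mem fun y hy => prod_mem fun x hx => ?_
  rw [div_eq_mul_inv]
  exact sub_mem (one_mem _) (mul_mem (mul_mem (tt_mem _ b)
    (xx_mem (Finset.mem_union_right _ (Finset.mem_filter.1 hy).1)))
    (xx_inv_mem (Finset.mem_union_left _ (Finset.mem_filter.1 hx).1)))

lemma symmOn_of_mem_LaurentIn (vert : X → Q0) {S T : Finset X} (hTS : Disjoint T S)
    {f : FF (X ⊕ Q1)} (hf : f ∈ LaurentIn Q1 S) : SymmOn Q1 vert T f := by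
  refine symmOn_iff.2 fun σ hσ => ?_
  have hx : ∀ x ∈ S, σ x = x := fun x hx => hσ.2 x (Finset.disjoint_right.1 hTS hx)
  have hle : LaurentIn Q1 S ≤ RingHom.eqLocus (act (permExt Q1 σ)) (RingHom.id _) := by
    refine Subring.closure_le.2 ?_
    rintro _ (((⟨x, hxS, rfl⟩ | ⟨x, hxS, rfl⟩) | ⟨b, rfl⟩) | ⟨b, rfl⟩)
    · simp [RingHom.mem_eqLocus, act_xx, hx x hxS]
    · simp [RingHom.mem_eqLocus, act_xx, hx x hxS]
    · simp [RingHom.mem_eqLocus, act_tt]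
    · simp [RingHom.mem_eqLocus, act_tt]
  exact hle hf

end Kernel

section Polynomial

open MvPolynomial

section Divisibility

variable {V : Type} [DecidableEq V]

/-- The substitution `X j ↦ X i`. -/
noncomputable def identifyVar (i j : V) : MvPolynomial V ℤ →ₐ[ℤ] MvPolynomial V ℤ :=
  rename fun v => if v = j then i else v

lemma X_sub_X_dvd_sub_identifyVar (i j : V) (p : MvPolynomial V ℤ) :
    X i - X j ∣ p - identifyVar i j p := by
  induction p using MvPolynomial.induction_on with
  | C a => simp
  | add p q hp hq =>
    rw [map_add, add_sub_add_comm]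
    exact dvd_add hp hq
  | mul_X p v hp =>
    have hv : X i - X j ∣ (X v - identifyVar i j (X v) : MvPolynomial V ℤ) := by
      by_cases h : v = j
      · simpa [identifyVar, h] using
          (dvd_sub_comm.2 dvd_rfl : X i - X j ∣ (X j - X i : MvPolynomial V ℤ))
      · simp [identifyVar, h]
    rw [map_mul, show p * X v - identifyVar i j p * identifyVar i j (X v) =
      (p - identifyVar i j p) * X v + identifyVar i j p * (X v - identifyVar i j (X v)) by ring]
    exact dvd_add (hp.mul_right _) (hv.mul_left _)

lemma X_sub_X_dvd_iff {i j : V} {p : MvPolynomial V ℤ} :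
    X i - X j ∣ p ↔ identifyVar i j p = 0 := by
  constructor
  · rintro ⟨q, rfl⟩
    simp [identifyVar]
  · intro h
    simpa [h] using X_sub_X_dvd_sub_identifyVar i j p

lemma prime_X_sub_X {i j : V} (hij : i ≠ j) : Prime (X i - X j : MvPolynomial V ℤ) := by
  refine ⟨sub_ne_zero.2 fun h => hij (X_injective h), fun h => ?_, fun a b h => ?_⟩
  · have := X_sub_X_dvd_iff.1 (h.dvd (a := 1))
    simp at this
  · simpa [X_sub_X_dvd_iff] using h

lemma X_sub_X_not_dvd {i j k l : V} (hkl : k ≠ l) (h₁ : ¬(k = i ∧ l = j))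
    (h₂ : ¬(k = j ∧ l = i)) : ¬(X i - X j : MvPolynomial V ℤ) ∣ X k - X l := by
  rw [X_sub_X_dvd_iff, map_sub, sub_eq_zero, identifyVar, rename_X, rename_X]
  intro h
  have := X_injective h
  split_ifs at this <;> grind

lemma X_sub_X_dvd_of_rename_swap {i j : V} {p : MvPolynomial V ℤ}
    (hp : rename (Equiv.swap i j) p = -p) : X i - X j ∣ p := by
  rw [X_sub_X_dvd_iff]
  have hfun : ((fun v => if v = j then i else v) ∘ Equiv.swap i j) =
      fun v => if v = j then i else v := by
    ext v
    simp only [Function.comp_apply, Equiv.swap_apply_def]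
    grind
  have h := congrArg (identifyVar i j) hp
  rw [identifyVar, rename_rename, hfun, map_neg] at h
  exact self_eq_neg.1 h

end Divisibility

variable {X₀ Q0 Q1 : Type}

/-- The inclusion of integral polynomials into rational functions. -/
noncomputable def toFF (V : Type) : MvPolynomial V ℤ →+* FF V :=
  (algebraMap (MvPolynomial V ℚ) (FF V)).comp (MvPolynomial.map (Int.castRingHom ℚ))

lemma toFF_injective (V : Type) : Function.Injective (toFF V) :=
  (IsFractionRing.injective (MvPolynomial V ℚ) (FF V)).comp
    (map_injective _ Int.cast_injective)

lemma toFF_X {V : Type} (v : V) : toFF V (X v) = xv v := by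
  simp [toFF, xv]

lemma toFF_rename {V : Type} (σ : Equiv.Perm V) (p : MvPolynomial V ℤ) :
    toFF V (rename σ p) = act σ (toFF V p) := by
  simp [toFF, act_algebraMap, map_rename]

variable [Fintype X₀] [DecidableEq X₀] [DecidableEq Q0]

/-- The antisymmetrizer on integral polynomials. -/
noncomputable def polyAlt (vert : X₀ → Q0) (S : Finset X₀) (p : MvPolynomial (X₀ ⊕ Q1) ℤ) :
    MvPolynomial (X₀ ⊕ Q1) ℤ :=
  ∑ σ with σ ∈ youngGroup vert S,
    ((Equiv.Perm.sign σ : ℤˣ) : ℤ) • rename (permExt Q1 σ) p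

lemma toFF_polyAlt (vert : X₀ → Q0) (S : Finset X₀) (p : MvPolynomial (X₀ ⊕ Q1) ℤ) :
    toFF _ (polyAlt vert S p) = Jsym vert S (toFF _ p) := by
  simp only [polyAlt, Jsym_eq, map_sum, map_zsmul, toFF_rename]

lemma X_sub_X_dvd_polyAlt {vert : X₀ → Q0} {S : Finset X₀} {x y : X₀} (hx : x ∈ S) (hy : y ∈ S)
    (hxy : x ≠ y) (hv : vert y = vert x) (p : MvPolynomial (X₀ ⊕ Q1) ℤ) :
    X (.inl x) - X (.inl y) ∣ polyAlt vert S p := by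
  classical
  apply X_sub_X_dvd_of_rename_swap
  apply toFF_injective
  have hswap : Equiv.swap (Sum.inl x : X₀ ⊕ Q1) (.inl y) = permExt Q1 (Equiv.swap x y) := by
    ext (z | b) <;> simp [permExt, Equiv.swap_apply_def]
  have hmem : Equiv.swap x y ∈ youngGroup vert S := by
    refine ⟨fun z => ?_, fun z hz => Equiv.swap_apply_of_ne_of_ne ?_ ?_⟩
    · rw [Equiv.swap_apply_def]
      grind
    · exact fun h => hz (h ▸ hx)
    · exact fun h => hz (h ▸ hy)
  rw [hswap, toFF_rename, toFF_polyAlt, act_Jsym hmem, Equiv.Perm.sign_swap hxy, map_neg,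
    toFF_polyAlt]
  simp

variable [LinearOrder X₀]

/-- The later variables of `S` at the vertex of `x`. -/
def later (vert : X₀ → Q0) (S : Finset X₀) (x : X₀) : Finset X₀ :=
  S.filter fun y => vert y = vert x ∧ x < y

/-- The product of the Vandermonde products of the variables of `S` at each vertex. -/
noncomputable def polyVand (Q1 : Type) (vert : X₀ → Q0) (S : Finset X₀) :
    MvPolynomial (X₀ ⊕ Q1) ℤ :=
  ∏ x ∈ S, ∏ y ∈ later vert S x, (X (.inl x) - X (.inl y))

lemma polyVand_dvd_polyAlt (vert : X₀ → Q0) (S : Finset X₀) (p : MvPolynomial (X₀ ⊕ Q1) ℤ) :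
    polyVand Q1 vert S ∣ polyAlt vert S p := by
  classical
  rw [polyVand, Finset.prod_sigma']
  refine Finset.prod_dvd_of_isRelPrime ?_ ?_
  · rintro ⟨x, y⟩ h ⟨z, w⟩ h' hne
    simp only [later, Finset.coe_sigma, Set.mem_sigma_iff, Finset.mem_coe, Finset.mem_filter]
      at h h'
    refine (prime_X_sub_X ?_).irreducible.isRelPrime_iff_not_dvd.2 (X_sub_X_not_dvd ?_ ?_ ?_)
    · simpa using h.2.2.2.ne
    · simpa using h'.2.2.2.ne
    · rintro ⟨h₁, h₂⟩
      simp only [Sum.inl.injEq] at h₁ h₂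
      exact hne (by rw [h₁, h₂])
    · rintro ⟨h₁, h₂⟩
      simp only [Sum.inl.injEq] at h₁ h₂
      subst h₁ h₂
      exact lt_asymm h.2.2.2 h'.2.2.2
  · rintro ⟨x, y⟩ h
    simp only [later, Finset.mem_sigma, Finset.mem_filter] at h
    exact X_sub_X_dvd_polyAlt h.1 h.2.1 h.2.2.2.ne h.2.2.1 p

lemma polyVand_isHomogeneous (vert : X₀ → Q0) (S : Finset X₀) :
    (polyVand Q1 vert S).IsHomogeneous (∑ x ∈ S, (later vert S x).card) := by
  refine IsHomogeneous.prod _ _ _ fun x _ => ?_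
  rw [Finset.card_eq_sum_ones]
  exact IsHomogeneous.prod _ _ _ fun y _ => (isHomogeneous_X _ _).sub (isHomogeneous_X _ _)

/-- The staircase monomial. -/
noncomputable def polyStair (Q1 : Type) (vert : X₀ → Q0) (S : Finset X₀) :
    MvPolynomial (X₀ ⊕ Q1) ℤ :=
  ∏ x ∈ S, X (.inl x) ^ (later vert S x).card

lemma toFF_polyStair (vert : X₀ → Q0) (S : Finset X₀) :
    toFF _ (polyStair Q1 vert S) = xmon Q1 (rhoS vert (· < ·) S) := by
  simp only [polyStair, map_prod, map_pow, toFF_X, xmon]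
  rw [← Finset.prod_subset (Finset.subset_univ S)]
  · refine Finset.prod_congr rfl fun x hx => ?_
    rw [rhoS, if_pos hx, zpow_natCast]
    rfl
  · intro x _ hx
    rw [rhoS, if_neg hx, zpow_zero]

lemma polyAlt_polyStair_isHomogeneous (vert : X₀ → Q0) (S : Finset X₀) :
    (polyAlt vert S (polyStair Q1 vert S)).IsHomogeneous (∑ x ∈ S, (later vert S x).card) := by
  refine (homogeneousSubmodule _ ℤ _).sum_mem fun σ _ => Submodule.smul_mem _ _ ?_
  refine IsHomogeneous.rename_isHomogeneous ?_
  refine IsHomogeneous.prod _ _ _ fun x _ => ?_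
  simpa using (isHomogeneous_X ℤ (Sum.inl x : X₀ ⊕ Q1)).pow (later vert S x).card

/-- The exponent of the staircase monomial. -/
noncomputable def stairExp (Q1 : Type) (vert : X₀ → Q0) (S : Finset X₀) : X₀ ⊕ Q1 →₀ ℕ :=
  ∑ x ∈ S, Finsupp.single (.inl x) (later vert S x).card

lemma stairExp_inl {vert : X₀ → Q0} {S : Finset X₀} {x : X₀} (hx : x ∈ S) :
    stairExp Q1 vert S (.inl x) = (later vert S x).card := by
  classical
  rw [stairExp, Finsupp.finsetSum_apply, Finset.sum_eq_single x]
  · simp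
  · intro y _ hy
    simp [hy]
  · exact fun h => absurd hx h

lemma polyStair_eq_monomial (vert : X₀ → Q0) (S : Finset X₀) :
    polyStair Q1 vert S = monomial (stairExp Q1 vert S) 1 := by
  simp only [polyStair, stairExp, X_pow_eq_monomial, monomial_sum_one]

lemma card_later_lt {vert : X₀ → Q0} {S : Finset X₀} {x y : X₀} (hy : y ∈ S)
    (hv : vert y = vert x) (hxy : x < y) :
    (later vert S y).card < (later vert S x).card := by
  refine Finset.card_lt_card ((Finset.ssubset_iff_of_subset fun z hz => ?_).2 ⟨y, ?_, ?_⟩)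
  · simp only [later, Finset.mem_filter] at hz ⊢
    exact ⟨hz.1, hz.2.1.trans hv, hxy.trans hz.2.2⟩
  · simp [later, hy, hv, hxy]
  · simp [later]

lemma eq_one_of_mapDomain_stairExp {vert : X₀ → Q0} {S : Finset X₀} {σ : Equiv.Perm X₀}
    (hσ : σ ∈ youngGroup vert S)
    (h : (stairExp Q1 vert S).mapDomain (permExt Q1 σ) = stairExp Q1 vert S) : σ = 1 := by
  ext x
  by_cases hx : x ∈ S
  · have hσx : σ x ∈ S := (apply_mem_iff hσ (.inl subset_rfl) x).2 hx
    have hc : (later vert S x).card = (later vert S (σ x)).card := by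
      have := DFunLike.congr_fun h (permExt Q1 σ (.inl x))
      rw [Finsupp.mapDomain_apply (permExt Q1 σ).injective, stairExp_inl hx] at this
      rwa [← stairExp_inl (Q1 := Q1) hσx]
    rcases lt_trichotomy (σ x) x with hlt | heq | hlt
    · exact absurd hc (card_later_lt hx (hσ.1 x).symm hlt).ne
    · exact heq
    · exact absurd hc (card_later_lt hσx (hσ.1 x) hlt).ne'
  · exact hσ.2 x hx

lemma coeff_polyAlt_polyStair (vert : X₀ → Q0) (S : Finset X₀) :
    coeff (stairExp Q1 vert S) (polyAlt vert S (polyStair Q1 vert S)) = 1 := by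
  classical
  rw [polyAlt, coeff_sum, Finset.sum_eq_single 1]
  · have : permExt Q1 (1 : Equiv.Perm X₀) = 1 := by ext (x | b) <;> rfl
    simp [this, polyStair_eq_monomial]
  · intro σ hσ hne
    rw [polyStair_eq_monomial, rename_monomial, coeff_smul, coeff_monomial, if_neg, smul_zero]
    exact fun h => hne (eq_one_of_mapDomain_stairExp (by simpa using hσ) h)
  · simp [one_mem]

lemma polyAlt_polyStair_ne_zero (vert : X₀ → Q0) (S : Finset X₀) :
    polyAlt vert S (polyStair Q1 vert S) ≠ 0 := fun h => by
  simpa [h] using coeff_polyAlt_polyStair (Q1 := Q1) vert S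

lemma polyAlt_polyStair_dvd_polyVand (vert : X₀ → Q0) (S : Finset X₀) :
    polyAlt vert S (polyStair Q1 vert S) ∣ polyVand Q1 vert S := by
  obtain ⟨q, hq⟩ := polyVand_dvd_polyAlt vert S (polyStair Q1 vert S)
  have hne := polyAlt_polyStair_ne_zero (Q1 := Q1) vert S
  have hV : polyVand Q1 vert S ≠ 0 := fun h => hne (by rw [hq, h, zero_mul])
  have hq0 : q ≠ 0 := fun h => hne (by rw [hq, h, mul_zero])
  have hdeg := (polyAlt_polyStair_isHomogeneous (Q1 := Q1) vert S).totalDegree hne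
  rw [hq, totalDegree_mul_of_isDomain hV hq0,
    (polyVand_isHomogeneous vert S).totalDegree hV, add_eq_left,
    totalDegree_eq_zero_iff_eq_C] at hdeg
  have hcoeff := coeff_polyAlt_polyStair (Q1 := Q1) vert S
  rw [hq, hdeg, mul_comm, coeff_C_mul] at hcoeff
  have hunit : IsUnit q := by
    rw [hdeg]
    exact (IsUnit.of_mul_eq_one _ hcoeff).map C
  rw [hq]
  exact hunit.mul_right_dvd.2 dvd_rfl

lemma Jsym_xmon_rhoS_ne_zero (vert : X₀ → Q0) (S : Finset X₀) :
    Jsym vert S (xmon Q1 (rhoS vert (· < ·) S)) ≠ 0 := by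
  rw [← toFF_polyStair, ← toFF_polyAlt]
  exact (map_ne_zero_iff _ (toFF_injective _)).2 (polyAlt_polyStair_ne_zero vert S)

/-- The substitution of `0` for the variables outside `S`. -/
noncomputable def restrictVars (Q1 : Type) (S : Finset X₀) :
    MvPolynomial (X₀ ⊕ Q1) ℤ →ₐ[ℤ] MvPolynomial (X₀ ⊕ Q1) ℤ :=
  aeval (Sum.elim (fun x => if x ∈ S then X (.inl x) else 0) fun b => X (.inr b))

lemma restrictVars_X_inl {S : Finset X₀} {x : X₀} (hx : x ∈ S) :
    restrictVars Q1 S (X (.inl x)) = X (.inl x) := by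
  simp [restrictVars, hx]

lemma restrictVars_X_inr (S : Finset X₀) (b : Q1) :
    restrictVars Q1 S (X (.inr b)) = X (.inr b) := by
  simp [restrictVars]

lemma restrictVars_rename {vert : X₀ → Q0} {S : Finset X₀} {σ : Equiv.Perm X₀}
    (hσ : σ ∈ youngGroup vert S) (p : MvPolynomial (X₀ ⊕ Q1) ℤ) :
    restrictVars Q1 S (rename (permExt Q1 σ) p) =
      rename (permExt Q1 σ) (restrictVars Q1 S p) := by
  suffices h : (restrictVars Q1 S).comp (rename (permExt Q1 σ)) =
      (rename (permExt Q1 σ)).comp (restrictVars Q1 S) from DFunLike.congr_fun h p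
  refine MvPolynomial.algHom_ext ?_
  rintro (x | b)
  · by_cases hx : x ∈ S <;>
      simp [restrictVars, permExt, hx, apply_mem_iff hσ (.inl subset_rfl)]
  · simp [restrictVars, permExt]

lemma restrictVars_polyAlt (vert : X₀ → Q0) (S : Finset X₀) (p : MvPolynomial (X₀ ⊕ Q1) ℤ) :
    restrictVars Q1 S (polyAlt vert S p) = polyAlt vert S (restrictVars Q1 S p) := by
  simp only [polyAlt, map_sum, map_zsmul]
  refine Finset.sum_congr rfl fun σ hσ => ?_
  rw [restrictVars_rename (by simpa using hσ)]

lemma restrictVars_polyStair (vert : X₀ → Q0) (S : Finset X₀) :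
    restrictVars Q1 S (polyStair Q1 vert S) = polyStair Q1 vert S := by
  simp only [polyStair, map_prod, map_pow]
  exact Finset.prod_congr rfl fun x hx => by rw [restrictVars_X_inl hx]

variable [Fintype Q1]

lemma toFF_restrictVars_mem (S : Finset X₀) (p : MvPolynomial (X₀ ⊕ Q1) ℤ) :
    toFF _ (restrictVars Q1 S p) ∈ LaurentIn Q1 S := by
  induction p using MvPolynomial.induction_on with
  | C a => simp [restrictVars, intCast_mem]
  | add p q hp hq => simpa using add_mem hp hq
  | mul_X p v hp =>
    rw [map_mul, map_mul]
    refine mul_mem hp ?_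
    rcases v with x | b
    · by_cases hx : x ∈ S
      · rw [restrictVars_X_inl hx, toFF_X]
        exact xx_mem hx
      · simp [restrictVars, hx]
    · rw [restrictVars_X_inr, toFF_X]
      exact tt_mem S b

/-- The product of all the variables of `S` and all the arrow variables. -/
noncomputable def allVars (Q1 : Type) [Fintype Q1] (S : Finset X₀) : MvPolynomial (X₀ ⊕ Q1) ℤ :=
  (∏ x ∈ S, X (.inl x)) * ∏ b, X (.inr b)

lemma toFF_allVars (S : Finset X₀) :
    toFF _ (allVars Q1 S) = (∏ x ∈ S, xx Q1 x) * ∏ b, tt X₀ b := by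
  simp [allVars, toFF_X, xx, tt]

lemma restrictVars_allVars (S : Finset X₀) : restrictVars Q1 S (allVars Q1 S) = allVars Q1 S := by
  simp only [allVars, map_mul, map_prod, restrictVars_X_inr]
  congr 1
  exact Finset.prod_congr rfl fun x hx => restrictVars_X_inl hx

lemma toFF_allVars_ne_zero (S : Finset X₀) : toFF _ (allVars Q1 S) ≠ 0 := by
  rw [toFF_allVars]
  exact mul_ne_zero (Finset.prod_ne_zero_iff.2 fun x _ => xx_ne_zero x)
    (Finset.prod_ne_zero_iff.2 fun b _ => tt_ne_zero b)

lemma toFF_allVars_inv_mem (S : Finset X₀) : (toFF _ (allVars Q1 S))⁻¹ ∈ LaurentIn Q1 S := by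
  rw [toFF_allVars, mul_inv, ← Finset.prod_inv_distrib, ← Finset.prod_inv_distrib]
  exact mul_mem (prod_mem fun x hx => xx_inv_mem hx) (prod_mem fun b _ => tt_inv_mem S b)

lemma symmOn_toFF_allVars (vert : X₀ → Q0) (S : Finset X₀) :
    SymmOn Q1 vert S (toFF _ (allVars Q1 S)) := by
  refine symmOn_iff.2 fun σ hσ => ?_
  simp only [toFF_allVars, map_mul, map_prod, act_xx, act_tt]
  congr 1
  exact Finset.prod_equiv σ (fun x => (apply_mem_iff hσ (.inl subset_rfl) x).symm) fun _ _ => rfl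

/-- Clearing denominators in a Laurent polynomial. -/
lemma exists_allVars_pow_mul_eq {S : Finset X₀} {f : FF (X₀ ⊕ Q1)} (hf : f ∈ LaurentIn Q1 S) :
    ∃ (n : ℕ) (p : MvPolynomial (X₀ ⊕ Q1) ℤ), restrictVars Q1 S p = p ∧
      f * toFF _ (allVars Q1 S) ^ n = toFF _ p := by
  classical
  have hM := restrictVars_allVars (Q1 := Q1) S
  induction hf using Subring.closure_induction with
  | mem f hf =>
    rcases hf with ((⟨x, hx, rfl⟩ | ⟨x, hx, rfl⟩) | ⟨b, rfl⟩) | ⟨b, rfl⟩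
    · exact ⟨0, X (.inl x), restrictVars_X_inl hx, by simp [toFF_X, xx]⟩
    · refine ⟨1, (∏ y ∈ S.erase x, X (.inl y)) * ∏ b, X (.inr b), ?_, ?_⟩
      · simp only [map_mul, map_prod, restrictVars_X_inr]
        congr 1
        exact Finset.prod_congr rfl fun y hy => restrictVars_X_inl (Finset.mem_of_mem_erase hy)
      · have hx0 := xx_ne_zero (Q1 := Q1) x
        rw [pow_one, allVars, ← Finset.mul_prod_erase S _ hx]
        simp only [map_mul, toFF_X, ← mul_assoc]
        change (xx Q1 x)⁻¹ * xx Q1 x * _ * _ = _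
        rw [inv_mul_cancel₀ hx0, one_mul]
    · exact ⟨0, X (.inr b), restrictVars_X_inr S b, by simp [toFF_X, tt]⟩
    · refine ⟨1, (∏ x ∈ S, X (.inl x)) * ∏ c ∈ Finset.univ.erase b, X (.inr c), ?_, ?_⟩
      · simp only [map_mul, map_prod, restrictVars_X_inr]
        congr 1
        exact Finset.prod_congr rfl fun y hy => restrictVars_X_inl hy
      · have hb0 := tt_ne_zero (X := X₀) b
        rw [pow_one, allVars, ← Finset.mul_prod_erase Finset.univ _ (Finset.mem_univ b),
          mul_left_comm]
        simp only [map_mul, toFF_X, ← mul_assoc]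
        change (tt X₀ b)⁻¹ * tt X₀ b * _ * _ = _
        rw [inv_mul_cancel₀ hb0, one_mul]
  | zero => exact ⟨0, 0, by simp, by simp⟩
  | one => exact ⟨0, 1, by simp, by simp⟩
  | add f g _ _ hf hg =>
    obtain ⟨n, p, hp, hfp⟩ := hf
    obtain ⟨k, q, hq, hgq⟩ := hg
    refine ⟨n + k, p * allVars Q1 S ^ k + q * allVars Q1 S ^ n, by simp [hp, hq, hM], ?_⟩
    simp only [map_add, map_mul, map_pow, ← hfp, ← hgq]
    ring
  | neg f _ hf =>
    obtain ⟨n, p, hp, hfp⟩ := hf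
    exact ⟨n, -p, by simp [hp], by simp [← hfp]⟩
  | mul f g _ _ hf hg =>
    obtain ⟨n, p, hp, hfp⟩ := hf
    obtain ⟨k, q, hq, hgq⟩ := hg
    refine ⟨n + k, p * q, by simp [hp, hq], ?_⟩
    rw [map_mul, ← hfp, ← hgq]
    ring

/-- The Demazure symmetrizer preserves Laurent polynomials. -/
lemma Dem_mem_LaurentIn (vert : X₀ → Q0) {S : Finset X₀} {f : FF (X₀ ⊕ Q1)}
    (hf : f ∈ LaurentIn Q1 S) : Dem vert (· < ·) S f ∈ LaurentIn Q1 S := by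
  obtain ⟨n, p, hp, hfp⟩ := exists_allVars_pow_mul_eq hf
  have hm := toFF_allVars_ne_zero (Q1 := Q1) S
  obtain ⟨q, hq⟩ := (polyAlt_polyStair_dvd_polyVand vert S).trans
    (polyVand_dvd_polyAlt vert S (polyStair Q1 vert S * p))
  have hq' := congrArg (restrictVars Q1 S) hq
  rw [map_mul, restrictVars_polyAlt, restrictVars_polyAlt, map_mul, restrictVars_polyStair,
    hp] at hq'
  have hsymm : SymmOn Q1 vert S (toFF _ (allVars Q1 S) ^ n) := symmOn_iff.2 fun σ hσ => by
    rw [map_pow, symmOn_iff.1 (symmOn_toFF_allVars vert S) σ hσ]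
  have key : Dem vert (· < ·) S f * toFF _ (allVars Q1 S) ^ n =
      toFF _ (restrictVars Q1 S q) := by
    rw [Dem, mul_assoc, ← Jsym_mul_of_symmOn hsymm, mul_assoc, hfp,
      inv_mul_eq_iff_eq_mul₀ (Jsym_xmon_rhoS_ne_zero vert S), ← toFF_polyStair, ← map_mul,
      ← toFF_polyAlt, ← toFF_polyAlt, ← map_mul, hq']
  have : Dem vert (· < ·) S f =
      toFF _ (restrictVars Q1 S q) * (toFF _ (allVars Q1 S))⁻¹ ^ n := by
    rw [← key, inv_pow, mul_inv_cancel_right₀ (pow_ne_zero n hm)]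
  rw [this]
  exact mul_mem (toFF_restrictVars_mem S q) (pow_mem (toFF_allVars_inv_mem S) n)

end Polynomial

end Shuffle

open Shuffle in
/-- the shuffle product `*` is well defined (it produces a Laurent polynomial
over `ℤ[t^{±1}]`, symmetric in the variables at each vertex) and associative. -/
theorem stmt_10
    (Q0 Q1 X : Type) [Fintype Q0] [DecidableEq Q0] [Fintype Q1] [DecidableEq Q1]
    [Fintype X] [DecidableEq X] [LinearOrder X]
    (hd tl : Q1 → Q0)
    -- the vertex of each variable; the variables in `A` at vertex `i` play the role of
    -- `u^{(i)}_1, …, u^{(i)}_{α^{(i)}}`, and similarly for `B`, `C`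
    (vert : X → Q0)
    (A B C : Finset X)
    (hAB : Disjoint A B) (hAC : Disjoint A C) (hBC : Disjoint B C)
    -- the variables are listed in the order: those of `A`, then `B`, then `C`
    (hABo : ∀ x ∈ A, ∀ y ∈ B, x < y)
    (hACo : ∀ x ∈ A, ∀ z ∈ C, x < z)
    (hBCo : ∀ y ∈ B, ∀ z ∈ C, y < z)
    (f g h : FF (X ⊕ Q1))
    (hfL : f ∈ LaurentIn Q1 A) (hfS : SymmOn Q1 vert A f)
    (hgL : g ∈ LaurentIn Q1 B) (hgS : SymmOn Q1 vert B g)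
    (hhL : h ∈ LaurentIn Q1 C) (hhS : SymmOn Q1 vert C h) :
    starMul vert hd tl (· < ·) A B f g ∈ LaurentIn Q1 (A ∪ B) ∧
    SymmOn Q1 vert (A ∪ B) (starMul vert hd tl (· < ·) A B f g) ∧
    starMul vert hd tl (· < ·) (A ∪ B) C (starMul vert hd tl (· < ·) A B f g) h
      = starMul vert hd tl (· < ·) A (B ∪ C) f (starMul vert hd tl (· < ·) B C g h) := by
  have hLap : f * g * kernelProd vert hd tl A B ∈ LaurentIn Q1 (A ∪ B) :=
    mul_mem (mul_mem (LaurentIn_mono Finset.subset_union_left hfL)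
      (LaurentIn_mono Finset.subset_union_right hgL)) (kernelProd_mem vert hd tl A B)
  refine ⟨Dem_mem_LaurentIn vert hLap, symmOn_Dem vert _ _ _, ?_⟩
  have hABC : Disjoint (A ∪ B) C := Finset.disjoint_union_left.2 ⟨hAC, hBC⟩
  have hBCA : Disjoint (B ∪ C) A := Finset.disjoint_union_left.2 ⟨hAB.symm, hAC.symm⟩
  have hleft : SymmOn Q1 vert (A ∪ B) (h * kernelProd vert hd tl (A ∪ B) C) :=
    (symmOn_of_mem_LaurentIn vert hABC hhL).mul
      (symmOn_kernelProd vert hd tl (.inl subset_rfl) (.inr hABC))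
  have hright : SymmOn Q1 vert (B ∪ C) (f * kernelProd vert hd tl A (B ∪ C)) :=
    (symmOn_of_mem_LaurentIn vert hBCA hfL).mul
      (symmOn_kernelProd vert hd tl (.inr hBCA) (.inl subset_rfl))
  have hρleft : ∀ y ∈ (A ∪ B ∪ C) \ (A ∪ B), ∀ x ∈ A ∪ B, ∀ x' ∈ A ∪ B, x < y → x' < y := by
    intro y hy x _ x' hx' _
    have hyC : y ∈ C := by
      simp only [Finset.mem_sdiff, Finset.mem_union] at hy
      tauto
    rcases Finset.mem_union.1 hx' with hx' | hx'
    · exact hACo x' hx' y hyC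
    · exact hBCo x' hx' y hyC
  have hρright : ∀ y ∈ (A ∪ (B ∪ C)) \ (B ∪ C), ∀ x ∈ B ∪ C, ∀ x' ∈ B ∪ C, x < y → x' < y := by
    intro y hy x hx _ _ hxy
    have hyA : y ∈ A := by
      simp only [Finset.mem_sdiff, Finset.mem_union] at hy
      tauto
    rcases Finset.mem_union.1 hx with hx | hx
    · exact absurd hxy (hABo y hyA x hx).asymm
    · exact absurd hxy (hACo y hyA x hx).asymm
  rw [starMul_eq, starMul_eq, starMul_eq, starMul_eq, mul_assoc (Dem _ _ _ _),
    Dem_Dem_mul Finset.subset_union_left hleft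
      (symmOn_xmon fun σ hσ => rhoS_sub_apply Finset.subset_union_left hρleft hσ)
      (Jsym_xmon_rhoS_ne_zero vert _),
    mul_comm f (Dem _ _ _ _), mul_assoc (Dem _ _ _ _),
    Dem_Dem_mul Finset.subset_union_right hright
      (symmOn_xmon fun σ hσ => rhoS_sub_apply Finset.subset_union_right hρright hσ)
      (Jsym_xmon_rhoS_ne_zero vert _),
    kernelProd_union_left vert hd tl hAB, kernelProd_union_right vert hd tl A hBC,
    Finset.union_assoc]
  congr 1
  ring
end
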